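/- Let n ≥ 1 and 0 < s < 1. Let u ∈ C^{1,1}_{loc}(ℝⁿ) ∩ L_{2s} be a nonnegative classical solution of (-Δ)^s u = g in B_1(0), where g ∈ L^∞(B_1(0)). Then for every 0 < ε < 2s, ‖u‖_{C^{[2s−ε],{2s−ε}}(B_{1/2}(0))} ≤ C (‖g‖_{L^∞(B_1(0))} + ‖u‖_{L^∞(B_1(0))}), where C depends only on n, s and ε. -/

import Mathlib

open MeasureTheory Metric Set Filter
open scoped Topology NNReal ENNReal RealInnerProductSpace

noncomputable section

/-- `n`-dimensional Euclidean space `ℝⁿ`. -/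
abbrev Euc (n : ℕ) := EuclideanSpace ℝ (Fin n)

/-- The standard normalization constant `C_{n,s}` of the fractional Laplacian,
`C_{n,s} = 4^s Γ(n/2+s) / (π^{n/2} |Γ(-s)|) = s·4^s·Γ(n/2+s) / (π^{n/2} Γ(1-s))`. -/
def fracC (n : ℕ) (s : ℝ) : ℝ :=
  s * 4 ^ s * Real.Gamma ((n : ℝ) / 2 + s) /
    (Real.pi ^ ((n : ℝ) / 2) * Real.Gamma (1 - s))

/-- `(-Δ)^s u (x) = v` in the classical (Cauchy principal value) sense: the truncated
integrals `C_{n,s} ∫_{|x-y| ≥ ε} (u(x) - u(y))/|x-y|^{n+2s} dy` tend to `v` as `ε → 0⁺`. -/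
def HasFracLapAt (n : ℕ) (s : ℝ) (u : Euc n → ℝ) (x : Euc n) (v : ℝ) : Prop :=
  Tendsto (fun ε : ℝ =>
      fracC n s *
        ∫ y in {y : Euc n | ε ≤ dist x y}, (u x - u y) / dist x y ^ ((n : ℝ) + 2 * s))
    (𝓝[>] (0 : ℝ)) (𝓝 v)

/-- The tail space `L_{2s}`: locally integrable functions with
`∫_{ℝⁿ} |u(y)|/(1+|y|^{n+2s}) dy < ∞`. -/
def MemL2s (n : ℕ) (s : ℝ) (u : Euc n → ℝ) : Prop :=
  LocallyIntegrable u volume ∧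
    Integrable (fun y : Euc n => |u y| / (1 + ‖y‖ ^ ((n : ℝ) + 2 * s))) volume

/-- The `L_{2s}` norm `‖u‖_{L_{2s}} = ∫_{ℝⁿ} |u(y)|/(1+|y|^{n+2s}) dy`. -/
def l2sNorm (n : ℕ) (s : ℝ) (u : Euc n → ℝ) : ℝ :=
  ∫ y : Euc n, |u y| / (1 + ‖y‖ ^ ((n : ℝ) + 2 * s))

/-- `u ∈ C^{1,1}_{loc}(Ω)`: near every point of `Ω`, `u` is `C^1` with a Lipschitz
continuous derivative. -/
def C11LocOn (n : ℕ) (u : Euc n → ℝ) (Ω : Set (Euc n)) : Prop :=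
  ∀ x ∈ Ω, ∃ ε > 0, ball x ε ⊆ Ω ∧ ContDiffOn ℝ 1 u (ball x ε) ∧
    ∃ L : ℝ≥0, LipschitzOnWith L (fun y => fderiv ℝ u y) (ball x ε)

/-- The `C^γ(K)` norm (`0 < γ < 1`) of `u` is bounded by `A`: both the sup norm and the
`γ`-Hölder seminorm of `u` on `K` are at most `A`. -/
def HolderBoundOn (n : ℕ) (γ : ℝ) (u : Euc n → ℝ) (K : Set (Euc n)) (A : ℝ) : Prop :=
  (∀ x ∈ K, |u x| ≤ A) ∧ ∀ x ∈ K, ∀ y ∈ K, |u x - u y| ≤ A * dist x y ^ γ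

/-- Two-sided (interior and exterior) tangent ball condition of radius `ρ` at a boundary
point `z` of `Ω`.  A uniform two-sided ball condition is the standard geometric
characterization of a (locally) `C^{1,1}` boundary: the radius `ρ` is controlled by the
local `C^{1,1}` norm of `∂Ω` and vice versa. -/
def TwoSidedBallAt (n : ℕ) (Ω : Set (Euc n)) (ρ : ℝ) (z : Euc n) : Prop :=
  ∃ ν : Euc n, ‖ν‖ = 1 ∧ ball (z + ρ • ν) ρ ⊆ Ω ∧ ball (z - ρ • ν) ρ ⊆ Ωᶜ

/-- The `C^{[γ],{γ}}(K)` norm of `u` is bounded by `A` (here `m = [γ]` and the real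
parameter `γfrac = {γ}` is the fractional part): `u` is `C^m`, all derivatives of order
`≤ m` are bounded by `A` on `K`, and the order-`m` derivative is `{γ}`-Hölder on `K`
with constant `A`. -/
def HigherHolderBoundOn (n : ℕ) (m : ℕ) (γfrac : ℝ) (u : Euc n → ℝ) (K : Set (Euc n))
    (A : ℝ) : Prop :=
  ContDiffOn ℝ m u K ∧
    (∀ k ≤ m, ∀ x ∈ K, ‖iteratedFDeriv ℝ k u x‖ ≤ A) ∧
    ∀ x ∈ K, ∀ y ∈ K,
      ‖iteratedFDeriv ℝ m u x - iteratedFDeriv ℝ m u y‖ ≤ A * dist x y ^ γfrac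

/-- The polynomially decaying weight `(1 + |x|)^{-p}`. -/
def decay {n : ℕ} (p : ℝ) (x : Euc n) : ℝ := (1 + ‖x‖) ^ (-p)

/-- The singular kernel `|y|^{-p}`. -/
def singKer {n : ℕ} (p : ℝ) (y : Euc n) : ℝ := ‖y‖ ^ (-p)

/-- The symmetric second difference `2 f(x) - f(x+y) - f(x-y)`. -/
def secondDiff {n : ℕ} {E : Type*} [NormedAddCommGroup E] [NormedSpace ℝ E]
    (f : Euc n → E) (x y : Euc n) : E := (2 : ℝ) • f x - f (x + y) - f (x - y)

/-- The symmetrized nonlocal operator `∫ |y|^{-p} (2 f(x) - f(x+y) - f(x-y)) dy`. -/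
def symLap {n : ℕ} {E : Type*} [NormedAddCommGroup E] [NormedSpace ℝ E]
    (p : ℝ) (f : Euc n → E) (x : Euc n) : E :=
  ∫ y, singKer p y • secondDiff f x y

section Weights

variable {n : ℕ} {p : ℝ}

lemma decay_pos (x : Euc n) : 0 < decay p x := by
  unfold decay; positivity

lemma singKer_nonneg (y : Euc n) : 0 ≤ singKer p y := by
  unfold singKer; positivity

lemma singKer_neg (y : Euc n) : singKer p (-y) = singKer p y := by
  simp [singKer]

lemma continuous_decay : Continuous (decay p : Euc n → ℝ) := by
  unfold decay
  refine Continuous.rpow_const (by fun_prop) fun x => Or.inl ?_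
  positivity

lemma measurable_singKer : Measurable (singKer p : Euc n → ℝ) := by
  unfold singKer; fun_prop

lemma integrable_decay (hp : n < p) : Integrable (decay p : Euc n → ℝ) :=
  integrable_one_add_norm (by simpa using hp)

lemma decay_le_one (hp : 0 < p) (x : Euc n) : decay p x ≤ 1 :=
  Real.rpow_le_one_of_one_le_of_nonpos (by linarith [norm_nonneg x]) (by linarith)

lemma decay_anti (hp : 0 < p) {x y : Euc n} (h : ‖x‖ ≤ ‖y‖) : decay p y ≤ decay p x :=
  Real.rpow_le_rpow_of_nonpos (by positivity) (by linarith) (by linarith)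

lemma decay_le_add (hp : 0 < p) (x y : Euc n) :
    decay p x ≤ (1 + ‖y‖) ^ p * decay p (x + y) := by
  unfold decay
  rw [Real.rpow_neg (by positivity), Real.rpow_neg (by positivity), ← div_eq_mul_inv,
    le_div_iff₀ (by positivity), inv_mul_le_iff₀ (by positivity),
    ← Real.mul_rpow (by positivity) (by positivity)]
  refine Real.rpow_le_rpow (by positivity) ?_ hp.le
  nlinarith [norm_add_le x y, norm_nonneg x, norm_nonneg y,
    mul_nonneg (norm_nonneg x) (norm_nonneg y)]

lemma decay_le_of_norm_le (hp : 0 < p) {x y : Euc n} {R : ℝ} (h : ‖y‖ ≤ R) :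
    decay p x ≤ (1 + R) ^ p * decay p (x + y) :=
  (decay_le_add hp x y).trans <| mul_le_mul_of_nonneg_right
    (Real.rpow_le_rpow (by positivity) (by linarith) hp.le) (decay_pos _).le

lemma decay_le_singKer (hp : 0 < p) {y : Euc n} (hy : y ≠ 0) : decay p y ≤ singKer p y :=
  Real.rpow_le_rpow_of_nonpos (by positivity) (by linarith) (by linarith)

lemma singKer_le_decay (hp : 0 < p) {y : Euc n} (hy : 1 ≤ ‖y‖) :
    singKer p y ≤ 2 ^ p * decay p y := by
  unfold singKer decay
  rw [Real.rpow_neg (by positivity), Real.rpow_neg (by positivity), ← div_eq_mul_inv,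
    le_div_iff₀ (by positivity), inv_mul_le_iff₀ (by positivity),
    ← Real.mul_rpow (by positivity) (by positivity)]
  exact Real.rpow_le_rpow (by positivity) (by linarith) hp.le

lemma one_le_decay (hp : 0 < p) {y : Euc n} {R : ℝ} (hy : ‖y‖ ≤ R) :
    1 ≤ (1 + R) ^ p * decay p y := by
  unfold decay
  rw [Real.rpow_neg (by positivity), ← div_eq_mul_inv, one_le_div₀ (by positivity)]
  exact Real.rpow_le_rpow (by positivity) (by linarith) hp.le

lemma decay_smul_le (hp : 0 < p) {τ : ℝ} (h0 : 0 < τ) (h1 : τ ≤ 1) (y : Euc n) :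
    decay p (τ • y) ≤ τ ^ (-p) * decay p y := by
  unfold decay
  rw [← Real.mul_rpow (by positivity) (by positivity), norm_smul, Real.norm_of_nonneg h0.le]
  refine Real.rpow_le_rpow_of_nonpos (by positivity) ?_ (by linarith)
  nlinarith

lemma decay_smul_le_of_one_le (hp : 0 < p) {τ : ℝ} (h1 : 1 ≤ τ) (y : Euc n) :
    decay p (τ • y) ≤ decay p y := by
  refine decay_anti hp ?_
  rw [norm_smul, Real.norm_of_nonneg (by linarith)]
  nlinarith [norm_nonneg y]

lemma singKer_smul {τ : ℝ} (h0 : 0 < τ) (y : Euc n) :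
    singKer p (τ • y) = τ ^ (-p) * singKer p y := by
  unfold singKer
  rw [norm_smul, Real.norm_of_nonneg h0.le, Real.mul_rpow h0.le (by positivity)]

lemma integrable_singKer_mul_min (hn : 1 ≤ n) (hp : n < p) (hp2 : p < n + 2) :
    Integrable (fun y : Euc n => singKer p y * min 1 (‖y‖ ^ 2)) := by
  have : Nonempty (Fin n) := ⟨⟨0, hn⟩⟩
  have key := integrable_fun_norm_addHaar (E := Euc n) volume
    (f := fun t : ℝ => t ^ (-p) * min 1 (t ^ 2))
  refine key.2 ?_
  have hd : Module.finrank ℝ (Euc n) = n := by simp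
  rw [hd, ← Ioc_union_Ioi_eq_Ioi (zero_le_one (α := ℝ))]
  have hcast : ((n - 1 : ℕ) : ℝ) = (n : ℝ) - 1 := by push_cast [hn]; ring
  refine IntegrableOn.union ?_ ?_
  · have h := (intervalIntegral.integrableOn_Ioo_rpow_iff (s := (n : ℝ) + 1 - p)
      (zero_lt_one (α := ℝ))).2 (by linarith)
    rw [← integrableOn_Ioc_iff_integrableOn_Ioo] at h
    refine h.congr_fun (fun t ht => ?_) measurableSet_Ioc
    have ht0 := ht.1
    have : min 1 (t ^ 2) = t ^ (2 : ℝ) := by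
      rw [min_eq_right (by nlinarith [ht.1, ht.2])]; norm_num
    simp only [this, smul_eq_mul]
    rw [← Real.rpow_natCast t (n - 1), ← Real.rpow_add ht0, ← Real.rpow_add ht0, hcast]
    congr 1; ring
  · have h := integrableOn_Ioi_rpow_of_lt (a := (n : ℝ) - 1 - p) (by linarith)
      (zero_lt_one (α := ℝ))
    refine h.congr_fun (fun t ht => ?_) measurableSet_Ioi
    have ht1 : 1 < t := ht
    have : min 1 (t ^ 2) = 1 := min_eq_left (by nlinarith)
    simp only [this, smul_eq_mul, mul_one]
    rw [← Real.rpow_natCast t (n - 1), ← Real.rpow_add (by linarith), hcast]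
    congr 1

end Weights

section SecondDifference

variable {n : ℕ} {E : Type*} [NormedAddCommGroup E] [NormedSpace ℝ E]

lemma norm_secondDiff_le_four {f : Euc n → E} {M : ℝ} (hM : ∀ x, ‖f x‖ ≤ M) (x y : Euc n) :
    ‖secondDiff f x y‖ ≤ 4 * M := by
  unfold secondDiff
  calc _ ≤ ‖(2 : ℝ) • f x‖ + ‖f (x + y)‖ + ‖f (x - y)‖ :=
        (norm_sub_le _ _).trans (add_le_add_left (norm_sub_le _ _) _)
    _ ≤ 2 * M + M + M := by
        rw [norm_smul]
        gcongr <;> first | exact hM _ | simp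
    _ = 4 * M := by ring

/-- A Lipschitz bound on the derivative along the segment `[x - y, x + y]` controls the second
difference quadratically. -/
lemma norm_secondDiff_le_sq {f : Euc n → E} {x y : Euc n} {r M : ℝ} (hy : ‖y‖ < r)
    (hd : ∀ a ∈ ball x r, DifferentiableAt ℝ f a)
    (hL : ∀ a ∈ ball x r, ∀ b ∈ ball x r, ‖fderiv ℝ f a - fderiv ℝ f b‖ ≤ M * ‖a - b‖) :
    ‖secondDiff f x y‖ ≤ 2 * M * ‖y‖ ^ 2 := by
  have hmem : ∀ t ∈ Icc (0 : ℝ) 1, x + t • y ∈ ball x r ∧ x - t • y ∈ ball x r := by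
    intro t ht
    have : ‖t • y‖ < r := by
      rw [norm_smul, Real.norm_of_nonneg ht.1]
      nlinarith [norm_nonneg y, ht.1, ht.2]
    simp [this]
  have hM : 0 ≤ M * ‖y‖ := by
    have h1 := hmem 1 (by simp)
    have h2 := hL _ h1.1 _ h1.2
    have : x + (1 : ℝ) • y - (x - (1 : ℝ) • y) = (2 : ℝ) • y := by
      rw [two_smul, one_smul]; abel
    rw [this, norm_smul] at h2
    have h3 := (norm_nonneg _).trans h2
    norm_num at h3
    linarith
  have hder : ∀ t ∈ Icc (0 : ℝ) 1,
      HasDerivWithinAt (fun t : ℝ => f (x + t • y) + f (x - t • y))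
        ((fderiv ℝ f (x + t • y) - fderiv ℝ f (x - t • y)) y) (Icc 0 1) t := by
    intro t ht
    have h1 : HasDerivAt (fun t : ℝ => x + t • y) y t := by
      simpa using ((hasDerivAt_id t).smul_const y).const_add x
    have h2 : HasDerivAt (fun t : ℝ => x - t • y) (-y) t := by
      simpa using ((hasDerivAt_id t).smul_const y).const_sub x
    have h3 := ((hd _ (hmem t ht).1).hasFDerivAt.comp_hasDerivAt t h1).add
      ((hd _ (hmem t ht).2).hasFDerivAt.comp_hasDerivAt t h2)
    refine (h3.congr_deriv ?_).hasDerivWithinAt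
    rw [map_neg, sub_apply, ← sub_eq_add_neg]
  have hb : ∀ t ∈ Ico (0 : ℝ) 1,
      ‖(fderiv ℝ f (x + t • y) - fderiv ℝ f (x - t • y)) y‖ ≤ 2 * M * ‖y‖ ^ 2 := by
    intro t ht
    have ht' : t ∈ Icc (0 : ℝ) 1 := ⟨ht.1, ht.2.le⟩
    refine (ContinuousLinearMap.le_opNorm _ _).trans ?_
    have h2 := hL _ (hmem t ht').1 _ (hmem t ht').2
    have : x + t • y - (x - t • y) = (2 * t) • y := by rw [two_mul, add_smul]; abel
    rw [this, norm_smul, Real.norm_of_nonneg (by linarith [ht.1])] at h2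
    calc _ ≤ (M * (2 * t * ‖y‖)) * ‖y‖ := by gcongr
      _ = 2 * t * ((M * ‖y‖) * ‖y‖) := by ring
      _ ≤ 2 * 1 * ((M * ‖y‖) * ‖y‖) := by
        gcongr
        exact ht.2.le
      _ = _ := by ring
  have h := norm_image_sub_le_of_norm_deriv_le_segment_01' hder hb
  have e : secondDiff f x y =
      -((f (x + (1 : ℝ) • y) + f (x - (1 : ℝ) • y)) -
        (f (x + (0 : ℝ) • y) + f (x - (0 : ℝ) • y))) := by
    simp only [secondDiff, one_smul, zero_smul, add_zero, sub_zero, two_smul]; abel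
  rw [e, norm_neg]
  exact h

lemma exists_norm_secondDiff_le_min {f : Euc n → E} (hf : ContDiff ℝ 2 f)
    (hc : HasCompactSupport f) :
    ∃ C, 0 ≤ C ∧ ∀ x y, ‖secondDiff f x y‖ ≤ C * min 1 (‖y‖ ^ 2) := by
  obtain ⟨M, hM⟩ := hc.exists_bound_of_continuous hf.continuous
  have h1 : ContDiff ℝ 1 (fderiv ℝ f) := hf.fderiv_right (by norm_num)
  obtain ⟨L, hL⟩ := h1.lipschitzWith_of_hasCompactSupport (hc.fderiv ℝ) (by norm_num)
  have hM0 : 0 ≤ M := (norm_nonneg _).trans (hM 0)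
  refine ⟨4 * M + 2 * L, by positivity, fun x y => ?_⟩
  have hA := norm_secondDiff_le_four hM x y
  have hB := norm_secondDiff_le_sq (f := f) (x := x) (y := y) (r := ‖y‖ + 1) (M := L) (by linarith)
    (fun a _ => (hf.differentiable (by norm_num)) a)
    (fun a _ b _ => by simpa [dist_eq_norm] using hL.dist_le_mul a b)
  rcases le_total 1 (‖y‖ ^ 2) with h | h
  · rw [min_eq_left h]; linarith [L.coe_nonneg]
  · rw [min_eq_right h]; nlinarith [sq_nonneg ‖y‖]

end SecondDifference

section SymLap

variable {n : ℕ} {p : ℝ} {E : Type*} [NormedAddCommGroup E] [NormedSpace ℝ E]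

lemma continuous_secondDiff {f : Euc n → E} (hf : Continuous f) :
    Continuous (fun z : Euc n × Euc n => secondDiff f z.1 z.2) := by
  unfold secondDiff; fun_prop

lemma continuous_secondDiff_right {f : Euc n → E} (hf : Continuous f) (x : Euc n) :
    Continuous (secondDiff f x) :=
  (continuous_secondDiff hf).comp (by fun_prop : Continuous fun y => (x, y))

lemma aestronglyMeasurable_singKer_smul {f : Euc n → E} (hf : Continuous f) (x : Euc n) :
    AEStronglyMeasurable (fun y => singKer p y • secondDiff f x y) volume :=
  measurable_singKer.aestronglyMeasurable.smul
    (continuous_secondDiff_right hf x).aestronglyMeasurable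

lemma integrable_symLap (hn : 1 ≤ n) (hp : n < p) (hp2 : p < n + 2) {f : Euc n → E}
    (hf : Continuous f) {x : Euc n} {C : ℝ}
    (hC : ∀ y, ‖secondDiff f x y‖ ≤ C * min 1 (‖y‖ ^ 2)) :
    Integrable (fun y => singKer p y • secondDiff f x y) := by
  refine ((integrable_singKer_mul_min hn hp hp2).const_mul C).mono'
    (aestronglyMeasurable_singKer_smul hf x) (Eventually.of_forall fun y => ?_)
  rw [norm_smul, Real.norm_of_nonneg (singKer_nonneg y)]
  calc _ ≤ singKer p y * (C * min 1 (‖y‖ ^ 2)) :=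
        mul_le_mul_of_nonneg_left (hC y) (singKer_nonneg y)
    _ = _ := by ring

/-- For a compactly supported `C²` function the integral defining `symLap` converges absolutely
and is dominated by the weight `decay p`. -/
lemma exists_integral_norm_symLap_le (hn : 1 ≤ n) (hp : n < p) (hp2 : p < n + 2)
    {f : Euc n → E} (hf : ContDiff ℝ 2 f) (hc : HasCompactSupport f) :
    ∃ C, 0 ≤ C ∧ ∀ x, Integrable (fun y => singKer p y • secondDiff f x y) ∧
      ∫ y, ‖singKer p y • secondDiff f x y‖ ≤ C * decay p x := by
  have hp0 : 0 < p := (Nat.cast_nonneg n).trans_lt hp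
  obtain ⟨C, hC0, hC⟩ := exists_norm_secondDiff_le_min hf hc
  have hInt : ∀ x, Integrable (fun y => singKer p y • secondDiff f x y) := fun x =>
    integrable_symLap hn hp hp2 hf.continuous (hC x)
  have hfi : Integrable f := hf.continuous.integrable_of_hasCompactSupport hc
  obtain ⟨R, hR0, hR⟩ := hc.isCompact.isBounded.subset_ball_lt 1 0
  have hsupp : ∀ z, R ≤ ‖z‖ → f z = 0 := fun z hz => by
    by_contra h
    have := hR (subset_tsupport f h)
    rw [mem_ball_zero_iff] at this
    linarith
  set I := ∫ y : Euc n, singKer p y * min 1 (‖y‖ ^ 2)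
  have hI : 0 ≤ I := integral_nonneg fun y => mul_nonneg (singKer_nonneg y) (by positivity)
  have hN : 0 ≤ ∫ y, ‖f y‖ := integral_nonneg fun y => norm_nonneg _
  refine ⟨C * I * (1 + 2 * R) ^ p + 2 * (4 ^ p * ∫ y, ‖f y‖), by positivity, fun x => ⟨hInt x, ?_⟩⟩
  have hd := decay_pos (p := p) x
  rcases le_total ‖x‖ (2 * R) with hx | hx
  · calc ∫ y, ‖singKer p y • secondDiff f x y‖
        ≤ ∫ y : Euc n, C * (singKer p y * min 1 (‖y‖ ^ 2)) := by
          refine integral_mono (hInt x).norm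
            ((integrable_singKer_mul_min hn hp hp2).const_mul C) fun y => ?_
          simp only [norm_smul, Real.norm_of_nonneg (singKer_nonneg y)]
          calc _ ≤ singKer p y * (C * min 1 (‖y‖ ^ 2)) :=
              mul_le_mul_of_nonneg_left (hC x y) (singKer_nonneg y)
            _ = _ := by ring
      _ = C * I * 1 := by rw [integral_const_mul, mul_one]
      _ ≤ C * I * ((1 + 2 * R) ^ p * decay p x) := by
          gcongr; exact one_le_decay hp0 hx
      _ ≤ _ := by
          rw [add_mul]
          have : 0 ≤ 2 * (4 ^ p * ∫ y, ‖f y‖) * decay p x := by positivity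
          linarith
  · have hbd : ∀ y z : Euc n, ‖x‖ ≤ ‖y‖ + ‖z‖ →
        singKer p y * ‖f z‖ ≤ 4 ^ p * decay p x * ‖f z‖ := by
      intro y z hxyz
      rcases le_total R ‖z‖ with hz | hz
      · simp [hsupp z hz]
      · refine mul_le_mul_of_nonneg_right ?_ (norm_nonneg _)
        have hy : (1 + ‖x‖) / 4 ≤ ‖y‖ := by linarith
        unfold singKer decay
        calc ‖y‖ ^ (-p) ≤ ((1 + ‖x‖) / 4) ^ (-p) :=
              Real.rpow_le_rpow_of_nonpos (by positivity) hy (by linarith)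
          _ = _ := by
            rw [Real.div_rpow (by positivity) (by positivity),
              Real.rpow_neg (by norm_num : (0:ℝ) ≤ 4)]
            field_simp
    have hi1 : Integrable fun y => ‖f (x + y)‖ := (hfi.comp_add_left x).norm
    have hi2 : Integrable fun y => ‖f (x - y)‖ := (hfi.comp_sub_left x).norm
    calc ∫ y, ‖singKer p y • secondDiff f x y‖
        ≤ ∫ y : Euc n, (4 ^ p * decay p x * ‖f (x + y)‖ + 4 ^ p * decay p x * ‖f (x - y)‖) := by
          refine integral_mono (hInt x).norm ((hi1.const_mul _).add (hi2.const_mul _)) fun y => ?_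
          have h1 := hbd y (x + y) (by
            have := norm_sub_le (x + y) y
            rw [add_sub_cancel_right] at this; linarith)
          have h2 := hbd y (x - y) (by
            have := norm_add_le (x - y) y
            rw [sub_add_cancel] at this; linarith)
          simp only [norm_smul, Real.norm_of_nonneg (singKer_nonneg y), secondDiff]
          rw [hsupp x (by linarith), smul_zero, zero_sub]
          calc _ ≤ singKer p y * (‖f (x + y)‖ + ‖f (x - y)‖) := by
                refine mul_le_mul_of_nonneg_left ?_ (singKer_nonneg y)
                exact (norm_sub_le _ _).trans (by rw [norm_neg])
            _ ≤ _ := by linarith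
      _ = 2 * (4 ^ p * ∫ y, ‖f y‖) * decay p x := by
          rw [integral_add (hi1.const_mul _) (hi2.const_mul _), integral_const_mul,
            integral_const_mul, integral_add_left_eq_self (fun y => ‖f y‖) x,
            integral_sub_left_eq_self (fun y => ‖f y‖) volume x]
          ring
      _ ≤ _ := by
          have : 0 ≤ C * I * (1 + 2 * R) ^ p := by positivity
          gcongr
          linarith

lemma exists_norm_symLap_le (hn : 1 ≤ n) (hp : n < p) (hp2 : p < n + 2)
    {f : Euc n → E} (hf : ContDiff ℝ 2 f) (hc : HasCompactSupport f) :
    ∃ C, 0 ≤ C ∧ ∀ x, ‖symLap p f x‖ ≤ C * decay p x := by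
  obtain ⟨C, hC0, hC⟩ := exists_integral_norm_symLap_le hn hp hp2 hf hc
  exact ⟨C, hC0, fun x => (norm_integral_le_integral_norm _).trans (hC x).2⟩

lemma hasFDerivAt_symLap (hn : 1 ≤ n) (hp : n < p) (hp2 : p < n + 2)
    {f : Euc n → E} (hf : ContDiff ℝ 3 f) (hc : HasCompactSupport f) (x : Euc n) :
    HasFDerivAt (symLap p f) (symLap p (fderiv ℝ f) x) x := by
  have hf1 : ContDiff ℝ 2 (fderiv ℝ f) := hf.fderiv_right (by norm_num)
  obtain ⟨C, hC0, hC⟩ := exists_norm_secondDiff_le_min hf1 (hc.fderiv ℝ)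
  obtain ⟨C', hC0', hC'⟩ := exists_norm_secondDiff_le_min (hf.of_le (by norm_num)) hc
  refine hasFDerivAt_integral_of_dominated_of_fderiv_le (s := univ)
    (F' := fun z y => singKer p y • secondDiff (fderiv ℝ f) z y)
    (bound := fun y => C * (singKer p y * min 1 (‖y‖ ^ 2))) univ_mem
    (Eventually.of_forall fun z => aestronglyMeasurable_singKer_smul hf.continuous z)
    (integrable_symLap hn hp hp2 hf.continuous (hC' x))
    (aestronglyMeasurable_singKer_smul hf1.continuous x)
    (Eventually.of_forall fun y z _ => ?_)
    ((integrable_singKer_mul_min hn hp hp2).const_mul C)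
    (Eventually.of_forall fun y z _ => ?_)
  · rw [norm_smul, Real.norm_of_nonneg (singKer_nonneg y)]
    calc _ ≤ singKer p y * (C * min 1 (‖y‖ ^ 2)) :=
          mul_le_mul_of_nonneg_left (hC z y) (singKer_nonneg y)
      _ = _ := by ring
  · have hd : ∀ w, HasFDerivAt f (fderiv ℝ f w) w := fun w =>
      (hf.differentiable (by norm_num) w).hasFDerivAt
    have h1 : HasFDerivAt (fun z => f (z + y)) (fderiv ℝ f (z + y)) z := by
      rw [hasFDerivAt_comp_add_right]; exact hd _
    have h2 : HasFDerivAt (fun z => f (z - y)) (fderiv ℝ f (z - y)) z := by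
      rw [hasFDerivAt_comp_sub]; exact hd _
    exact ((((hd z).const_smul (2 : ℝ)).sub h1).sub h2).const_smul (singKer p y)

lemma symLap_comp_smul_sub {τ : ℝ} (hτ : 0 < τ) (f : Euc n → E) (x z : Euc n) :
    symLap p (fun z => f (τ • (z - x))) z = τ ^ (p - n) • symLap p f (τ • (z - x)) := by
  have hτn : (0 : ℝ) < τ ^ n := by positivity
  have h := Measure.integral_comp_smul (volume : Measure (Euc n))
    (fun y => singKer p y • secondDiff f (τ • (z - x)) y) τ
  rw [finrank_euclideanSpace_fin, abs_of_pos (by positivity)] at h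
  have e : ∀ y : Euc n, singKer p y • secondDiff (fun z => f (τ • (z - x))) z y =
      τ ^ p • (singKer p (τ • y) • secondDiff f (τ • (z - x)) (τ • y)) := by
    intro y
    rw [singKer_smul hτ, smul_smul, ← mul_assoc, ← Real.rpow_add hτ, add_neg_cancel,
      Real.rpow_zero, one_mul]
    simp only [secondDiff, ← smul_add, ← smul_sub, add_sub_right_comm, sub_right_comm]
  unfold symLap
  simp_rw [e]
  rw [integral_smul, h, smul_smul, Real.rpow_sub hτ, Real.rpow_natCast, div_eq_mul_inv]

lemma symLap_comp_isometry (A : Euc n ≃ₗᵢ[ℝ] Euc n) {f : Euc n → E} (hf : ∀ x, f (A x) = f x)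
    (x : Euc n) : symLap p f (A x) = symLap p f x := by
  unfold symLap
  rw [← A.measurePreserving.integral_comp A.toHomeomorph.measurableEmbedding]
  refine integral_congr_ae (Eventually.of_forall fun y => ?_)
  simp only [singKer, secondDiff, A.norm_map, ← map_add, ← map_sub, hf]

lemma symLap_eq_of_norm_eq {f : Euc n → E} (hf : ∀ x y : Euc n, ‖x‖ = ‖y‖ → f x = f y)
    {x y : Euc n} (h : ‖x‖ = ‖y‖) : symLap p f x = symLap p f y := by
  have := symLap_comp_isometry (p := p) ((ℝ ∙ (x - y))ᗮ.reflection)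
    (fun z => hf _ _ ((ℝ ∙ (x - y))ᗮ.reflection.norm_map z)) x
  rw [Submodule.reflection_sub h] at this
  exact this.symm

end SymLap

/-- Continuous functions with finite weighted `L¹` norm whose second differences are locally
uniformly quadratic: on these the symmetrized operator is defined by an absolutely convergent
integral. -/
structure Tame {n : ℕ} (p : ℝ) (u : Euc n → ℝ) : Prop where
  continuous : Continuous u
  integrable : Integrable (fun x => decay p x * u x)
  quadratic : ∀ R : ℝ, ∃ M, 0 ≤ M ∧ ∀ x, ‖x‖ ≤ R → ∀ y, ‖y‖ ≤ 1 →
    |secondDiff u x y| ≤ M * ‖y‖ ^ 2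

section TameFunctions

variable {n : ℕ} {p : ℝ} {u : Euc n → ℝ}

lemma Tame.exists_bound (hu : Tame p u) (R : ℝ) : ∃ B, 0 ≤ B ∧ ∀ x, ‖x‖ ≤ R → |u x| ≤ B := by
  obtain ⟨B, hB⟩ := (isCompact_closedBall (0 : Euc n) R).exists_bound_of_continuousOn
    hu.continuous.continuousOn
  exact ⟨max B 0, le_max_right _ _, fun x hx =>
    (hB x (mem_closedBall_zero_iff.2 hx)).trans (le_max_left _ _)⟩

lemma Tame.integrable_abs (hu : Tame p u) : Integrable (fun x => decay p x * |u x|) := by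
  refine hu.integrable.norm.congr (Eventually.of_forall fun x => ?_)
  simp [abs_of_pos (decay_pos x)]

lemma decay_neg (x : Euc n) : decay p (-x) = decay p x := by simp [decay]

lemma Tame.exists_integral_le (hn : 1 ≤ n) (hp : n < p) (hp2 : p < n + 2) (hu : Tame p u)
    (R : ℝ) : ∃ C, 0 ≤ C ∧ ∀ x, ‖x‖ ≤ R →
      Integrable (fun y => singKer p y • secondDiff u x y) ∧
      ∫ y, ‖singKer p y • secondDiff u x y‖ ≤ C := by
  have hp0 : 0 < p := (Nat.cast_nonneg n).trans_lt hp
  obtain ⟨M, hM0, hM⟩ := hu.quadratic R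
  obtain ⟨B, hB0, hB⟩ := hu.exists_bound R
  have hk := integrable_singKer_mul_min hn hp hp2
  have hd : Integrable (decay p : Euc n → ℝ) := integrable_decay hp
  have hN := hu.integrable_abs
  set I := ∫ y : Euc n, singKer p y * min 1 (‖y‖ ^ 2) with hI
  have hI0 : 0 ≤ I := integral_nonneg fun y => mul_nonneg (singKer_nonneg y) (by positivity)
  set J := ∫ y : Euc n, decay p y with hJ
  have hJ0 : 0 ≤ J := integral_nonneg fun y => (decay_pos y).le
  set N := ∫ y : Euc n, decay p y * |u y| with hNdef
  have hN0 : 0 ≤ N := integral_nonneg fun y => mul_nonneg (decay_pos y).le (abs_nonneg _)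
  rcases lt_or_ge R 0 with hR | hR
  · exact ⟨0, le_rfl, fun x hx => absurd (norm_nonneg x) (by linarith)⟩
  refine ⟨M * I + 2 ^ p * (2 * B * J + (1 + R) ^ p * N + (1 + R) ^ p * N), by positivity,
    fun x hx => ?_⟩
  set D : Euc n → ℝ := fun y => M * (singKer p y * min 1 (‖y‖ ^ 2)) + 2 ^ p * (2 * B * decay p y +
    (1 + R) ^ p * (decay p (x + y) * |u (x + y)|) + (1 + R) ^ p * (decay p (x - y) * |u (x - y)|))
    with hD
  have i1 : Integrable fun y => decay p (x + y) * |u (x + y)| := hN.comp_add_left x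
  have i2 : Integrable fun y => decay p (x - y) * |u (x - y)| := hN.comp_sub_left x
  have iD : Integrable D := (hk.const_mul M).add
    ((((hd.const_mul _).add (i1.const_mul _)).add (i2.const_mul _)).const_mul _)
  have hle : ∀ y, ‖singKer p y • secondDiff u x y‖ ≤ D y := by
    intro y
    rw [norm_smul, Real.norm_of_nonneg (singKer_nonneg y), Real.norm_eq_abs]
    have hk0 := singKer_nonneg (p := p) y
    have hd0 := decay_pos (p := p) y
    have t2 : 0 ≤ 2 ^ p * (2 * B * decay p y + (1 + R) ^ p * (decay p (x + y) * |u (x + y)|) +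
        (1 + R) ^ p * (decay p (x - y) * |u (x - y)|)) := by
      have := decay_pos (p := p) (x + y)
      have := decay_pos (p := p) (x - y)
      positivity
    rcases le_total ‖y‖ 1 with hy | hy
    · have hmin : min 1 (‖y‖ ^ 2) = ‖y‖ ^ 2 := min_eq_right (by nlinarith [norm_nonneg y])
      have := mul_le_mul_of_nonneg_left (hM x hx y hy) hk0
      simp only [hD, hmin]
      nlinarith
    · have t1 : 0 ≤ M * (singKer p y * min 1 (‖y‖ ^ 2)) := by positivity
      have e1 : decay p y ≤ (1 + R) ^ p * decay p (x + y) := by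
        rw [add_comm x y]; exact decay_le_of_norm_le hp0 hx
      have e2 : decay p y ≤ (1 + R) ^ p * decay p (x - y) := by
        rw [← decay_neg, sub_eq_neg_add]; exact decay_le_of_norm_le hp0 hx
      have h4 : |secondDiff u x y| ≤ 2 * B + |u (x + y)| + |u (x - y)| := by
        unfold secondDiff
        have := hB x hx
        calc _ ≤ |(2 : ℝ) • u x| + |u (x + y)| + |u (x - y)| :=
              (abs_sub _ _).trans (add_le_add_left (abs_sub _ _) _)
          _ ≤ _ := by rw [smul_eq_mul, abs_mul, abs_two]; gcongr
      calc singKer p y * |secondDiff u x y|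
          ≤ (2 ^ p * decay p y) * (2 * B + |u (x + y)| + |u (x - y)|) :=
            mul_le_mul (singKer_le_decay hp0 hy) h4 (abs_nonneg _) (by positivity)
        _ = 2 ^ p * (2 * B * decay p y + decay p y * |u (x + y)| + decay p y * |u (x - y)|) := by
            ring
        _ ≤ 2 ^ p * (2 * B * decay p y + ((1 + R) ^ p * decay p (x + y)) * |u (x + y)| +
              ((1 + R) ^ p * decay p (x - y)) * |u (x - y)|) := by gcongr
        _ ≤ D y := by simp only [hD]; rw [mul_assoc, mul_assoc]; linarith
  have hInt : Integrable (fun y => singKer p y • secondDiff u x y) :=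
    iD.mono' (aestronglyMeasurable_singKer_smul hu.continuous x) (Eventually.of_forall hle)
  refine ⟨hInt, (integral_mono hInt.norm iD hle).trans (le_of_eq ?_)⟩
  have j1 : Integrable fun y => 2 * B * decay p y + (1 + R) ^ p * (decay p (x + y) * |u (x + y)|) :=
    (hd.const_mul _).add (i1.const_mul _)
  have j2 : Integrable fun y => 2 * B * decay p y + (1 + R) ^ p * (decay p (x + y) * |u (x + y)|) +
      (1 + R) ^ p * (decay p (x - y) * |u (x - y)|) := j1.add (i2.const_mul _)
  simp only [hD]
  rw [integral_add (hk.const_mul M) (j2.const_mul _), integral_const_mul, integral_const_mul,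
    integral_add j1 (i2.const_mul _),
    integral_add (hd.const_mul _) (i1.const_mul _), integral_const_mul, integral_const_mul,
    integral_const_mul, integral_add_left_eq_self (fun y => decay p y * |u y|) x,
    integral_sub_left_eq_self (fun y => decay p y * |u y|) volume x]

lemma Tame.integrable_symLap (hn : 1 ≤ n) (hp : n < p) (hp2 : p < n + 2) (hu : Tame p u)
    (x : Euc n) : Integrable (fun y => singKer p y • secondDiff u x y) := by
  obtain ⟨C, -, hC⟩ := hu.exists_integral_le hn hp hp2 ‖x‖
  exact (hC x le_rfl).1

lemma Tame.exists_abs_symLap_le (hn : 1 ≤ n) (hp : n < p) (hp2 : p < n + 2) (hu : Tame p u)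
    (R : ℝ) : ∃ C, 0 ≤ C ∧ ∀ x, ‖x‖ ≤ R → |symLap p u x| ≤ C := by
  obtain ⟨C, h0, hC⟩ := hu.exists_integral_le hn hp hp2 R
  exact ⟨C, h0, fun x hx => (norm_integral_le_integral_norm _).trans (hC x hx).2⟩

lemma stronglyMeasurable_symLap {f : Euc n → ℝ} (hf : Continuous f) :
    StronglyMeasurable (symLap p f) := by
  unfold symLap
  refine StronglyMeasurable.integral_prod_right (f := fun x y => singKer p y • secondDiff f x y) ?_
  refine Measurable.stronglyMeasurable ?_
  exact (measurable_singKer.comp measurable_snd).smul (continuous_secondDiff hf).measurable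

lemma tame_of_C11LocOn (hC : C11LocOn n u univ) (hloc : Continuous u)
    (hInt : Integrable (fun x => decay p x * u x)) : Tame p u := by
  refine ⟨hloc, hInt, fun R => ?_⟩
  have hK := (isCompact_closedBall (0 : Euc n) R).prod (isCompact_closedBall (0 : Euc n) 1)
  have key : ∃ M, 0 ≤ M ∧ ∀ z ∈ closedBall (0 : Euc n) R ×ˢ closedBall (0 : Euc n) 1,
      |secondDiff u z.1 z.2| ≤ M * ‖z.2‖ ^ 2 := by
    refine hK.induction_on (p := fun S => ∃ M, 0 ≤ M ∧ ∀ z ∈ S,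
      |secondDiff u z.1 z.2| ≤ M * ‖z.2‖ ^ 2) ⟨0, le_rfl, by simp⟩ ?_ ?_ ?_
    · rintro S T hST ⟨M, h0, hM⟩
      exact ⟨M, h0, fun z hz => hM z (hST hz)⟩
    · rintro S T ⟨M, h0, hM⟩ ⟨M', h0', hM'⟩
      refine ⟨max M M', le_max_of_le_left h0, fun z hz => ?_⟩
      rcases hz with hz | hz
      · exact (hM z hz).trans (by gcongr; exact le_max_left _ _)
      · exact (hM' z hz).trans (by gcongr; exact le_max_right _ _)
    · rintro ⟨x, y⟩ -
      by_cases hy : y = 0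
      · subst hy
        obtain ⟨r, hr, -, hcd, L, hL⟩ := hC x (mem_univ _)
        refine ⟨ball x (r / 2) ×ˢ ball (0 : Euc n) (r / 2), mem_nhdsWithin_of_mem_nhds
          (prod_mem_nhds (ball_mem_nhds _ (by linarith)) (ball_mem_nhds _ (by linarith))),
          2 * L, by positivity, ?_⟩
        rintro ⟨a, b⟩ ⟨ha, hb⟩
        have hsub : ball a (r / 2) ⊆ ball x r := ball_subset_ball' (by
          have := mem_ball.1 ha; linarith)
        refine norm_secondDiff_le_sq (f := u) (x := a) (y := b) (r := r / 2)
          (by simpa using hb) (fun c hc => ?_)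
          (fun c hc d hd => ?_)
        · exact (hcd.differentiableOn (by norm_num) c (hsub hc)).differentiableAt
            (isOpen_ball.mem_nhds (hsub hc))
        · simpa [dist_eq_norm] using hL.dist_le_mul c (hsub hc) d (hsub hd)
      · have hc : ContinuousAt
            (fun z : Euc n × Euc n => |secondDiff u z.1 z.2| / ‖z.2‖ ^ 2) (x, y) := by
          refine ContinuousAt.div (continuous_secondDiff hloc).abs.continuousAt
            (by fun_prop) (by simpa using hy)
        have h1 := hc.eventually (gt_mem_nhds (lt_add_one _))
        have h2 : ∀ᶠ z : Euc n × Euc n in 𝓝 (x, y), z.2 ≠ 0 :=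
          continuous_snd.continuousAt.eventually_ne hy
        refine ⟨_, mem_nhdsWithin_of_mem_nhds (h1.and h2),
          |secondDiff u x y| / ‖y‖ ^ 2 + 1, by positivity, ?_⟩
        rintro ⟨a, b⟩ ⟨hab, hb⟩
        have hb' : 0 < ‖b‖ ^ 2 := by have := norm_pos_iff.2 hb; positivity
        exact ((div_lt_iff₀ hb').1 hab).le
  obtain ⟨M, h0, hM⟩ := key
  exact ⟨M, h0, fun x hx y hy => hM (x, y) ⟨by simpa using hx, by simpa using hy⟩⟩

end TameFunctions

section Classical

variable {n : ℕ} {p s : ℝ} {u : Euc n → ℝ}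

lemma C11LocOn.continuous (hC : C11LocOn n u univ) : Continuous u := by
  refine continuous_iff_continuousAt.2 fun x => ?_
  obtain ⟨r, hr, -, hcd, -⟩ := hC x (mem_univ _)
  exact hcd.continuousOn.continuousAt (ball_mem_nhds x hr)

lemma MemL2s.integrable_decay_mul (hs : 0 ≤ (n : ℝ) + 2 * s) (hu : MemL2s n s u)
    (hc : Continuous u) : Integrable (fun x => decay ((n : ℝ) + 2 * s) x * u x) := by
  refine (hu.2.const_mul 2).mono' (continuous_decay.mul hc).aestronglyMeasurable
    (Eventually.of_forall fun x => ?_)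
  rw [norm_mul, Real.norm_of_nonneg (decay_pos x).le, Real.norm_eq_abs]
  have : decay ((n : ℝ) + 2 * s) x ≤ 2 / (1 + ‖x‖ ^ ((n : ℝ) + 2 * s)) := by
    unfold decay
    rw [Real.rpow_neg (by positivity), le_div_iff₀ (by positivity),
      inv_mul_le_iff₀ (by positivity)]
    have h1 : ‖x‖ ^ ((n : ℝ) + 2 * s) ≤ (1 + ‖x‖) ^ ((n : ℝ) + 2 * s) :=
      Real.rpow_le_rpow (by positivity) (by linarith) hs
    have h2 : (1 : ℝ) ≤ (1 + ‖x‖) ^ ((n : ℝ) + 2 * s) :=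
      Real.one_le_rpow (by linarith [norm_nonneg x]) hs
    linarith
  calc _ ≤ 2 / (1 + ‖x‖ ^ ((n : ℝ) + 2 * s)) * |u x| := by gcongr
    _ = _ := by ring

lemma Tame.integrableOn_singKer (hp : 0 < p) (hu : Tame p u) (x : Euc n) {ε : ℝ} (hε : 0 < ε)
    (hd : Integrable (decay p : Euc n → ℝ)) :
    IntegrableOn (fun z => singKer p z * (u x - u (x + z))) {z | ε ≤ ‖z‖} := by
  have hN : Integrable fun z => decay p (x + z) * |u (x + z)| := hu.integrable_abs.comp_add_left x
  have hms : MeasurableSet {z : Euc n | ε ≤ ‖z‖} :=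
    measurableSet_le measurable_const measurable_norm
  have hdom : Integrable fun z => (1 + ε⁻¹) ^ p * (|u x| * decay p z +
      (1 + ‖x‖) ^ p * (decay p (x + z) * |u (x + z)|)) :=
    ((hd.const_mul _).add (hN.const_mul _)).const_mul _
  refine hdom.integrableOn.mono' ?_ ?_
  · exact (measurable_singKer.mul
      (continuous_const.sub (hu.continuous.comp (continuous_const.add continuous_id))).measurable
      ).aestronglyMeasurable
  · refine (ae_restrict_iff' hms).2 (Eventually.of_forall fun z (hz : ε ≤ ‖z‖) => ?_)
    have hz0 : 0 < ‖z‖ := hε.trans_le hz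
    rw [norm_mul, Real.norm_of_nonneg (singKer_nonneg z), Real.norm_eq_abs]
    have h1 : singKer p z ≤ (1 + ε⁻¹) ^ p * decay p z := by
      unfold singKer decay
      rw [Real.rpow_neg (by positivity), Real.rpow_neg (by positivity), ← div_eq_mul_inv,
        le_div_iff₀ (by positivity), inv_mul_le_iff₀ (by positivity),
        ← Real.mul_rpow (by positivity) (by positivity)]
      refine Real.rpow_le_rpow (by positivity) ?_ hp.le
      have : 1 ≤ ‖z‖ * ε⁻¹ := by rw [← div_eq_mul_inv, one_le_div₀ hε]; exact hz
      linarith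
    have h2 : decay p z ≤ (1 + ‖x‖) ^ p * decay p (x + z) := by
      rw [add_comm x z]; exact decay_le_add hp z x
    have hd0 := decay_pos (p := p) z
    calc singKer p z * |u x - u (x + z)|
        ≤ ((1 + ε⁻¹) ^ p * decay p z) * (|u x| + |u (x + z)|) := by
          gcongr; exact abs_sub _ _
      _ = (1 + ε⁻¹) ^ p * (|u x| * decay p z + decay p z * |u (x + z)|) := by ring
      _ ≤ (1 + ε⁻¹) ^ p * (|u x| * decay p z +
            ((1 + ‖x‖) ^ p * decay p (x + z)) * |u (x + z)|) := by
          gcongr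
      _ = _ := by ring

/-- The principal value operator coincides with the symmetrized one. -/
lemma HasFracLapAt.eq_symLap (hn : 1 ≤ n) (hs0 : 0 < s) (hs1 : s < 1)
    (hu : Tame ((n : ℝ) + 2 * s) u) {x : Euc n} {v : ℝ} (h : HasFracLapAt n s u x v) :
    v = fracC n s / 2 * symLap ((n : ℝ) + 2 * s) u x := by
  set p : ℝ := (n : ℝ) + 2 * s with hpdef
  have hp : n < p := by linarith
  have hp0 : 0 < p := (Nat.cast_nonneg n).trans_lt hp
  have hd : Integrable (decay p : Euc n → ℝ) := integrable_decay hp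
  refine tendsto_nhds_unique h ?_
  have hms : ∀ ε : ℝ, MeasurableSet {z : Euc n | ε ≤ ‖z‖} := fun ε =>
    measurableSet_le measurable_const measurable_norm
  have htrunc : ∀ ε : ℝ, 0 < ε →
      fracC n s * ∫ y in {y : Euc n | ε ≤ dist x y}, (u x - u y) / dist x y ^ p =
      fracC n s / 2 * ∫ z, {z : Euc n | ε ≤ ‖z‖}.indicator
        (fun z => singKer p z • secondDiff u x z) z := by
    intro ε hε
    have hInt := hu.integrableOn_singKer hp0 x hε hd
    have e1 : ∫ y in {y : Euc n | ε ≤ dist x y}, (u x - u y) / dist x y ^ p =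
        ∫ z in {z : Euc n | ε ≤ ‖z‖}, singKer p z * (u x - u (x + z)) := by
      rw [← integral_indicator (measurableSet_le measurable_const (by fun_prop)),
        ← integral_indicator (hms ε), ← integral_add_left_eq_self _ x]
      refine integral_congr_ae (Eventually.of_forall fun z => ?_)
      simp only [indicator_apply, mem_ofPred_eq, dist_self_add_right, singKer]
      split_ifs
      · rw [Real.rpow_neg (norm_nonneg _), div_eq_inv_mul]
      · rfl
    have hInt' : IntegrableOn (fun z => singKer p z * (u x - u (x - z))) {z | ε ≤ ‖z‖} := by
      have h1 := (integrable_indicator_iff (hms ε)).2 hInt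
      refine (integrable_indicator_iff (hms ε)).1 (h1.comp_neg.congr
        (Eventually.of_forall fun z => ?_))
      simp [indicator_apply, singKer_neg, ← sub_eq_add_neg]
    have e2 : ∫ z in {z : Euc n | ε ≤ ‖z‖}, singKer p z * (u x - u (x + z)) =
        ∫ z in {z : Euc n | ε ≤ ‖z‖}, singKer p z * (u x - u (x - z)) := by
      rw [← integral_indicator (hms ε), ← integral_indicator (hms ε), ← integral_neg_eq_self]
      refine integral_congr_ae (Eventually.of_forall fun z => ?_)
      simp [indicator_apply, singKer_neg, ← sub_eq_add_neg]
    rw [e1, integral_indicator (hms ε)]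
    have e3 : ∫ z in {z : Euc n | ε ≤ ‖z‖}, singKer p z • secondDiff u x z =
        (∫ z in {z : Euc n | ε ≤ ‖z‖}, singKer p z * (u x - u (x + z))) +
        ∫ z in {z : Euc n | ε ≤ ‖z‖}, singKer p z * (u x - u (x - z)) := by
      rw [← integral_add hInt hInt']
      refine integral_congr_ae (Eventually.of_forall fun z => ?_)
      simp only [secondDiff, smul_eq_mul]; ring
    rw [e3, ← e2]; ring
  have hInt := hu.integrable_symLap hn hp (by linarith) x
  have hlim : Tendsto (fun ε : ℝ => fracC n s / 2 * ∫ z, {z : Euc n | ε ≤ ‖z‖}.indicator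
        (fun z => singKer p z • secondDiff u x z) z) (𝓝[>] 0)
      (𝓝 (fracC n s / 2 * symLap p u x)) := by
    refine Tendsto.const_mul _ ?_
    refine tendsto_integral_filter_of_dominated_convergence _
      (Eventually.of_forall fun ε => hInt.1.indicator (hms ε))
      (Eventually.of_forall fun ε => Eventually.of_forall fun z =>
        norm_indicator_le_norm_self _ _) hInt.norm (Eventually.of_forall fun z => ?_)
    by_cases hz : z = 0
    · have : secondDiff u x z = 0 := by simp [hz, secondDiff, two_mul]
      simp [indicator_apply, this]
    · refine tendsto_const_nhds.congr' ?_
      have : ∀ᶠ ε : ℝ in 𝓝[>] 0, ε < ‖z‖ :=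
        mem_nhdsWithin_of_mem_nhds (gt_mem_nhds (norm_pos_iff.2 hz))
      filter_upwards [this] with ε hε
      rw [indicator_of_mem (by exact hε.le)]
  refine hlim.congr' ?_
  filter_upwards [self_mem_nhdsWithin] with ε hε
  exact (htrunc ε hε).symm

end Classical

section Duality

variable {n : ℕ} {p : ℝ} {u Θ : Euc n → ℝ}

/-- Symmetry of the operator against compactly supported test functions. -/
lemma Tame.integral_symLap_mul (hn : 1 ≤ n) (hp : n < p) (hp2 : p < n + 2) (hu : Tame p u)
    (hΘ : ContDiff ℝ 2 Θ) (hc : HasCompactSupport Θ) :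
    ∫ x, symLap p Θ x * u x = ∫ x, Θ x * symLap p u x := by
  obtain ⟨C, hC0, hC⟩ := exists_integral_norm_symLap_le hn hp hp2 hΘ hc
  obtain ⟨R, hR0, hR⟩ := hc.isCompact.isBounded.subset_ball_lt 0 0
  obtain ⟨C', hC0', hC'⟩ := hu.exists_integral_le hn hp hp2 R
  have hΘi : Integrable Θ := hΘ.continuous.integrable_of_hasCompactSupport hc
  have hzero : ∀ x, R < ‖x‖ → Θ x = 0 := fun x hx => by
    by_contra h
    have := hR (subset_tsupport Θ h)
    rw [mem_ball_zero_iff] at this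
    linarith
  have hF : Integrable (Function.uncurry fun x y => Θ x * (singKer p y • secondDiff u x y))
      (volume.prod volume) := by
    have hm : AEStronglyMeasurable
        (Function.uncurry fun x y => Θ x * (singKer p y • secondDiff u x y))
        ((volume : Measure (Euc n)).prod (volume : Measure (Euc n))) :=
      ((hΘ.continuous.measurable.comp measurable_fst).mul
        ((measurable_singKer.comp measurable_snd).smul
          (continuous_secondDiff hu.continuous).measurable)).aestronglyMeasurable
    refine (integrable_prod_iff hm).2 ⟨Eventually.of_forall fun x => ?_, ?_⟩
    · show Integrable (fun y => Θ x * (singKer p y • secondDiff u x y)) volume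
      exact (hu.integrable_symLap hn hp hp2 x).const_mul (Θ x)
    · refine (hΘi.norm.mul_const C').mono' hm.norm.integral_prod_right'
        (Eventually.of_forall fun x => ?_)
      simp only [Function.uncurry, norm_mul]
      rw [integral_const_mul, norm_mul, norm_norm]
      rcases lt_or_ge R ‖x‖ with hx | hx
      · simp [hzero x hx]
      · gcongr
        rw [Real.norm_of_nonneg (by positivity)]
        simpa only [norm_smul, norm_mul, smul_eq_mul] using (hC' x hx).2
  have hG : Integrable (Function.uncurry fun x y => (singKer p y • secondDiff Θ x y) * u x)
      (volume.prod volume) := by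
    have hm : AEStronglyMeasurable
        (Function.uncurry fun x y => (singKer p y • secondDiff Θ x y) * u x)
        ((volume : Measure (Euc n)).prod (volume : Measure (Euc n))) :=
      (((measurable_singKer.comp measurable_snd).smul
          (continuous_secondDiff hΘ.continuous).measurable).mul
        (hu.continuous.measurable.comp measurable_fst)).aestronglyMeasurable
    refine (integrable_prod_iff hm).2 ⟨Eventually.of_forall fun x => ?_, ?_⟩
    · show Integrable (fun y => (singKer p y • secondDiff Θ x y) * u x) volume
      exact (hC x).1.mul_const (u x)
    · refine (hu.integrable_abs.const_mul C).mono' hm.norm.integral_prod_right'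
        (Eventually.of_forall fun x => ?_)
      simp only [Function.uncurry, norm_mul]
      rw [integral_mul_const, norm_mul, norm_norm, ← mul_assoc]
      rw [Real.norm_of_nonneg (by positivity)]
      refine mul_le_mul_of_nonneg_right ?_ (norm_nonneg _)
      simpa only [norm_smul, norm_mul, smul_eq_mul] using (hC x).2
  have hmul : ∀ w : Euc n, Integrable fun x => Θ x * u (x + w) := fun w =>
    (hΘ.continuous.mul (hu.continuous.comp (continuous_id.add continuous_const))
      ).integrable_of_hasCompactSupport hc.mul_right
  have hmul' : ∀ w : Euc n, Integrable fun x => Θ (x + w) * u x := fun w => by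
    simpa [add_assoc] using (hmul (-w)).comp_add_right w
  have hshift : ∀ w : Euc n, ∫ x, Θ (x + w) * u x = ∫ x, Θ x * u (x + -w) := fun w => by
    rw [← integral_add_right_eq_self (fun x => Θ x * u (x + -w)) w]
    simp [add_assoc]
  have hswap : ∀ y : Euc n, ∫ x, Θ x * (singKer p y • secondDiff u x y) =
      ∫ x, (singKer p y • secondDiff Θ x y) * u x := by
    intro y
    have a0 : Integrable fun x => Θ x * u x := by simpa using hmul 0
    have e1 : ∀ x, Θ x * (singKer p y • secondDiff u x y) =
        singKer p y * (2 * (Θ x * u x) - Θ x * u (x + y) - Θ x * u (x + -y)) := fun x => by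
      simp only [secondDiff, smul_eq_mul, sub_eq_add_neg]; ring
    have e2 : ∀ x, (singKer p y • secondDiff Θ x y) * u x =
        singKer p y * (2 * (Θ x * u x) - Θ (x + y) * u x - Θ (x + -y) * u x) := fun x => by
      simp only [secondDiff, smul_eq_mul, sub_eq_add_neg]; ring
    simp_rw [e1, e2]
    have b1 : Integrable fun x => 2 * (Θ x * u x) - Θ x * u (x + y) :=
      (a0.const_mul 2).sub (hmul y)
    have b2 : Integrable fun x => 2 * (Θ x * u x) - Θ (x + y) * u x :=
      (a0.const_mul 2).sub (hmul' y)
    rw [integral_const_mul, integral_const_mul, integral_sub b1 (hmul (-y)),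
      integral_sub (a0.const_mul 2) (hmul y), integral_sub b2 (hmul' (-y)),
      integral_sub (a0.const_mul 2) (hmul' y), hshift, hshift, neg_neg]
    ring
  calc ∫ x, symLap p Θ x * u x
      = ∫ x, ∫ y, (singKer p y • secondDiff Θ x y) * u x := by
        simp only [symLap, integral_mul_const]
    _ = ∫ y, ∫ x, (singKer p y • secondDiff Θ x y) * u x := integral_integral_swap hG
    _ = ∫ y, ∫ x, Θ x * (singKer p y • secondDiff u x y) := by simp_rw [hswap]
    _ = ∫ x, ∫ y, Θ x * (singKer p y • secondDiff u x y) := (integral_integral_swap hF).symm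
    _ = ∫ x, Θ x * symLap p u x := by simp only [symLap, integral_const_mul]

end Duality

section Profile

/-- A radial bump supported in the ball of radius `1/8`. -/
def radialBump {n : ℕ} (x : Euc n) : ℝ := Real.smoothTransition (1 / 64 - ‖x‖ ^ 2)

variable {n : ℕ}

lemma contDiff_radialBump : ContDiff ℝ 4 (radialBump : Euc n → ℝ) :=
  (Real.smoothTransition.contDiff (n := 4)).comp (contDiff_const.sub (contDiff_norm_sq ℝ))

lemma radialBump_nonneg (x : Euc n) : 0 ≤ radialBump x := Real.smoothTransition.nonneg _

lemma radialBump_eq_zero {x : Euc n} (hx : 1 / 8 ≤ ‖x‖) : radialBump x = 0 :=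
  Real.smoothTransition.zero_of_nonpos (by nlinarith)

lemma hasCompactSupport_radialBump : HasCompactSupport (radialBump : Euc n → ℝ) :=
  HasCompactSupport.intro (isCompact_closedBall 0 (1 / 8)) fun x hx =>
    radialBump_eq_zero (by
      rw [mem_closedBall_zero_iff, not_le] at hx
      exact hx.le)

lemma integral_radialBump_pos : 0 < ∫ x : Euc n, radialBump x := by
  refine contDiff_radialBump.continuous.integral_pos_of_hasCompactSupport_nonneg_nonzero
    hasCompactSupport_radialBump (fun x => radialBump_nonneg x) (x := 0) ?_
  exact (Real.smoothTransition.pos_of_pos (by norm_num)).ne'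

lemma integral_radialBump_mul_sin (ξ : Euc n) :
    ∫ x : Euc n, radialBump x * Real.sin ⟪ξ, x⟫ = 0 := by
  have h := integral_neg_eq_self (fun x : Euc n => radialBump x * Real.sin ⟪ξ, x⟫) volume
  simp only [radialBump, norm_neg, inner_neg_right, Real.sin_neg, mul_neg, integral_neg] at h ⊢
  linarith

/-- The self-convolution of the radial bump; its Fourier transform is nonnegative. -/
def profile {n : ℕ} (x : Euc n) : ℝ := ∫ t, radialBump t * radialBump (x - t)

lemma profile_eq : (profile : Euc n → ℝ) =
    convolution radialBump radialBump (ContinuousLinearMap.lsmul ℝ ℝ) volume := by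
  ext x
  simp [profile, convolution_def]

lemma contDiff_profile : ContDiff ℝ 4 (profile : Euc n → ℝ) := by
  rw [profile_eq]
  exact hasCompactSupport_radialBump.contDiff_convolution_left (n := 4) _ contDiff_radialBump
    contDiff_radialBump.continuous.locallyIntegrable

lemma hasCompactSupport_profile : HasCompactSupport (profile : Euc n → ℝ) := by
  rw [profile_eq]
  exact hasCompactSupport_radialBump.convolution _ hasCompactSupport_radialBump

lemma profile_nonneg (x : Euc n) : 0 ≤ profile x :=
  integral_nonneg fun _ => mul_nonneg (radialBump_nonneg _) (radialBump_nonneg _)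

lemma profile_eq_zero {x : Euc n} (hx : 1 / 4 ≤ ‖x‖) : profile x = 0 := by
  refine integral_eq_zero_of_ae (Eventually.of_forall fun t => ?_)
  rcases le_or_gt (1 / 8) ‖t‖ with h | h
  · simp [radialBump_eq_zero h]
  · have : 1 / 8 ≤ ‖x - t‖ := by linarith [norm_sub_norm_le x t]
    simp [radialBump_eq_zero this]

lemma profile_eq_of_norm_eq {x y : Euc n} (h : ‖x‖ = ‖y‖) : profile x = profile y := by
  set A := (ℝ ∙ (x - y))ᗮ.reflection with hA
  have hxy : A x = y := Submodule.reflection_sub h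
  rw [← hxy]
  unfold profile
  rw [← A.measurePreserving.integral_comp A.toHomeomorph.measurableEmbedding
    (fun t => radialBump t * radialBump (A x - t))]
  refine integral_congr_ae (Eventually.of_forall fun t => ?_)
  simp only [radialBump, ← map_sub, A.norm_map]

lemma integral_profile_mul_cos (ξ : Euc n) :
    ∫ x : Euc n, profile x * Real.cos ⟪ξ, x⟫ =
      (∫ x : Euc n, radialBump x * Real.cos ⟪ξ, x⟫) ^ 2 := by
  set c : Euc n → ℝ := fun x => radialBump x * Real.cos ⟪ξ, x⟫ with hc
  set d : Euc n → ℝ := fun x => radialBump x * Real.sin ⟪ξ, x⟫ with hd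
  have hcc : Continuous c := contDiff_radialBump.continuous.mul (by fun_prop)
  have hdc : Continuous d := contDiff_radialBump.continuous.mul (by fun_prop)
  have hcs : HasCompactSupport c := hasCompactSupport_radialBump.mul_right
  have hds : HasCompactSupport d := hasCompactSupport_radialBump.mul_right
  have hci := hcc.integrable_of_hasCompactSupport hcs (μ := volume)
  have hdi := hdc.integrable_of_hasCompactSupport hds (μ := volume)
  have e : ∀ x : Euc n, profile x * Real.cos ⟪ξ, x⟫ =
      convolution c c (ContinuousLinearMap.lsmul ℝ ℝ) volume x -
        convolution d d (ContinuousLinearMap.lsmul ℝ ℝ) volume x := by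
    intro x
    rw [convolution_lsmul, convolution_lsmul, profile, ← integral_mul_const, ← integral_sub]
    · refine integral_congr_ae (Eventually.of_forall fun t => ?_)
      have : (⟪ξ, x⟫ : ℝ) = ⟪ξ, t⟫ + ⟪ξ, x - t⟫ := by rw [← inner_add_right]; simp
      simp only [hc, hd, smul_eq_mul]
      rw [this, Real.cos_add]; ring
    · exact (hcc.smul (hcc.comp (continuous_const.sub continuous_id))
        ).integrable_of_hasCompactSupport hcs.smul_right
    · exact (hdc.smul (hdc.comp (continuous_const.sub continuous_id))
        ).integrable_of_hasCompactSupport hds.smul_right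
  have hi : ∀ f : Euc n → ℝ, Integrable f →
      Integrable (convolution f f (ContinuousLinearMap.lsmul ℝ ℝ) volume) := fun f hf =>
    hf.integrable_convolution _ hf
  simp_rw [e]
  rw [integral_sub (hi c hci) (hi d hdi), integral_convolution _ hci hci,
    integral_convolution _ hdi hdi, integral_radialBump_mul_sin]
  simp [pow_two]

lemma integral_profile_mul_cos_nonneg (ξ : Euc n) :
    0 ≤ ∫ x : Euc n, profile x * Real.cos ⟪ξ, x⟫ := by
  rw [integral_profile_mul_cos]; positivity

lemma exists_le_integral_profile_mul_cos (n : ℕ) :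
    ∃ c : ℝ, 0 < c ∧ ∀ ξ : Euc n, ‖ξ‖ ≤ 1 → c ≤ ∫ x : Euc n, profile x * Real.cos ⟪ξ, x⟫ := by
  have hpos : 0 < ∫ x : Euc n, profile x := by
    have := integral_profile_mul_cos (0 : Euc n)
    simp only [inner_zero_left, Real.cos_zero, mul_one] at this
    rw [this]; exact pow_pos integral_radialBump_pos 2
  have hi : Integrable (profile : Euc n → ℝ) :=
    contDiff_profile.continuous.integrable_of_hasCompactSupport hasCompactSupport_profile
  refine ⟨Real.cos 1 * ∫ x : Euc n, profile x, mul_pos Real.cos_one_pos hpos, fun ξ hξ => ?_⟩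
  rw [← integral_const_mul]
  refine integral_mono (hi.const_mul _) ?_ fun x => ?_
  · exact (contDiff_profile.continuous.mul (by fun_prop)).integrable_of_hasCompactSupport
      hasCompactSupport_profile.mul_right
  · dsimp only
    rcases le_or_gt ‖x‖ 1 with hx | hx
    · rw [mul_comm, ← Real.cos_abs ⟪ξ, x⟫]
      refine mul_le_mul_of_nonneg_left ?_ (profile_nonneg x)
      refine Real.cos_le_cos_of_nonneg_of_le_pi (abs_nonneg _) (by linarith [Real.pi_gt_three])
        ((abs_real_inner_le_norm ξ x).trans ?_)
      nlinarith [norm_nonneg ξ, norm_nonneg x]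
    · rw [profile_eq_zero (by linarith)]; simp

end Profile

section Waves

variable {n : ℕ} {p : ℝ}

lemma tame_const (hp : n < p) (c : ℝ) : Tame p (fun _ : Euc n => c) where
  continuous := continuous_const
  integrable := (integrable_decay hp).mul_const c
  quadratic R := ⟨0, le_rfl, fun x _ y _ => by simp [secondDiff]; ring_nf⟩

lemma symLap_const (c : ℝ) (x : Euc n) : symLap p (fun _ : Euc n => c) x = 0 := by
  have : ∀ y, secondDiff (fun _ : Euc n => c) x y = 0 := fun y => by
    simp [secondDiff]; ring
  simp [symLap, this]

/-- The plane wave `cos⟨ξ, x⟩`. -/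
def wave {n : ℕ} (ξ x : Euc n) : ℝ := Real.cos ⟪ξ, x⟫

/-- The symbol of the symmetrized operator. -/
def waveSymbol {n : ℕ} (p : ℝ) (ξ : Euc n) : ℝ :=
  ∫ y : Euc n, singKer p y * (2 - 2 * Real.cos ⟪ξ, y⟫)

lemma continuous_wave (ξ : Euc n) : Continuous (wave ξ) := by unfold wave; fun_prop

lemma secondDiff_wave (ξ x y : Euc n) :
    secondDiff (wave ξ) x y = (2 - 2 * Real.cos ⟪ξ, y⟫) * wave ξ x := by
  simp only [secondDiff, wave, inner_add_right, inner_sub_right, Real.cos_add, Real.cos_sub,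
    smul_eq_mul]
  ring

lemma two_sub_two_mul_cos_le (t : ℝ) : 2 - 2 * Real.cos t ≤ t ^ 2 := by
  linarith [Real.one_sub_sq_div_two_le_cos (x := t)]

lemma tame_wave (hp : n < p) (ξ : Euc n) : Tame p (wave ξ) where
  continuous := continuous_wave ξ
  integrable := (integrable_decay hp).mono'
    (continuous_decay.mul (continuous_wave ξ)).aestronglyMeasurable
    (Eventually.of_forall fun x => by
      rw [norm_mul, Real.norm_of_nonneg (decay_pos x).le]
      exact mul_le_of_le_one_right (decay_pos x).le (Real.abs_cos_le_one _))
  quadratic R := by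
    refine ⟨‖ξ‖ ^ 2, by positivity, fun x _ y _ => ?_⟩
    rw [secondDiff_wave, abs_mul, abs_of_nonneg (by linarith [Real.cos_le_one ⟪ξ, y⟫])]
    refine (mul_le_of_le_one_right (by linarith [Real.cos_le_one ⟪ξ, y⟫])
      (Real.abs_cos_le_one _)).trans ((two_sub_two_mul_cos_le _).trans ?_)
    rw [← mul_pow, ← sq_abs]
    gcongr
    exact abs_real_inner_le_norm ξ y

lemma symLap_wave (ξ x : Euc n) : symLap p (wave ξ) x = waveSymbol p ξ * wave ξ x := by
  unfold symLap waveSymbol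
  rw [← integral_mul_const]
  simp_rw [secondDiff_wave, smul_eq_mul, mul_assoc]

lemma waveSymbol_smul {τ : ℝ} (hτ : 0 < τ) (ξ : Euc n) :
    waveSymbol p (τ • ξ) = τ ^ (p - n) * waveSymbol p ξ := by
  have h := symLap_comp_smul_sub (p := p) hτ (wave ξ) 0 0
  have e : (fun z : Euc n => wave ξ (τ • (z - 0))) = wave (τ • ξ) := by
    ext z; simp [wave, inner_smul_left, inner_smul_right]
  rw [e, symLap_wave] at h
  simpa [symLap_wave, wave] using h

lemma waveSymbol_pos (hn : 1 ≤ n) (hp : n < p) (hp2 : p < n + 2) {ξ : Euc n} (hξ : ξ ≠ 0) :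
    0 < waveSymbol p ξ := by
  have hi := (tame_wave hp ξ).integrable_symLap hn hp hp2 0
  have e : (fun y => singKer p y • secondDiff (wave ξ) 0 y) =
      fun y => singKer p y * (2 - 2 * Real.cos ⟪ξ, y⟫) := by
    ext y; simp [secondDiff_wave, wave]
  rw [e] at hi
  have h0 : ∀ y : Euc n, 0 ≤ singKer p y * (2 - 2 * Real.cos ⟪ξ, y⟫) := fun y =>
    mul_nonneg (singKer_nonneg y) (by linarith [Real.cos_le_one ⟪ξ, y⟫])
  refine (integral_pos_iff_support_of_nonneg h0 hi).2 ?_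
  have hc : Continuous fun y : Euc n => (⟪ξ, y⟫ : ℝ) := by fun_prop
  have ho : IsOpen ((fun y : Euc n => (⟪ξ, y⟫ : ℝ)) ⁻¹' Ioo 0 1) := isOpen_Ioo.preimage hc
  have hne : ((fun y : Euc n => (⟪ξ, y⟫ : ℝ)) ⁻¹' Ioo 0 1).Nonempty := by
    refine ⟨((2 * ‖ξ‖ ^ 2)⁻¹ : ℝ) • ξ, ?_⟩
    have : ‖ξ‖ ≠ 0 := norm_ne_zero_iff.2 hξ
    rw [mem_preimage, inner_smul_right, real_inner_self_eq_norm_sq]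
    have : (2 * ‖ξ‖ ^ 2)⁻¹ * ‖ξ‖ ^ 2 = 1 / 2 := by field_simp
    rw [this]; norm_num
  refine (ho.measure_pos volume hne).trans_le (measure_mono fun y hy => ?_)
  rw [Function.mem_support]
  have hy0 : y ≠ 0 := by rintro rfl; simp at hy
  have h1 : Real.cos ⟪ξ, y⟫ < 1 := by
    rw [← Real.cos_zero]
    exact Real.cos_lt_cos_of_nonneg_of_le_pi le_rfl
      (by have := hy.2; linarith [Real.pi_gt_three]) hy.1
  have h2 : 0 < singKer p y := Real.rpow_pos_of_pos (norm_pos_iff.2 hy0) _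
  exact (mul_pos h2 (by linarith)).ne'

end Waves

section Averaging

variable {n : ℕ} {p : ℝ} {E : Type*} [NormedAddCommGroup E] [NormedSpace ℝ E]

lemma norm_sub_le_decay_mul (hp : 0 < p) {k : Euc n → E} {k' : Euc n → Euc n →L[ℝ] E} {C : ℝ}
    (hk : ∀ x, HasFDerivAt k (k' x) x) (h0 : 0 ≤ C) (hC : ∀ x, ‖k' x‖ ≤ C * decay p x)
    {a b : Euc n} (hab : ‖a - b‖ ≤ 1) :
    ‖k a - k b‖ ≤ C * 2 ^ p * decay p a * ‖a - b‖ := by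
  rw [norm_sub_rev, norm_sub_rev a b]
  refine (convex_closedBall a 1).norm_image_sub_le_of_norm_hasFDerivWithin_le
    (fun x _ => (hk x).hasFDerivWithinAt) (fun x hx => (hC x).trans ?_)
    (mem_closedBall_self zero_le_one) (by rwa [mem_closedBall, dist_eq_norm, norm_sub_rev])
  have h1 : ‖a - x‖ ≤ 1 := by
    rw [mem_closedBall, dist_eq_norm] at hx; rwa [norm_sub_rev]
  have h2 := decay_le_of_norm_le hp (x := x) h1
  rw [add_sub_cancel] at h2
  rw [mul_assoc]
  norm_num at h2
  gcongr

/-- The operator applied to the profile. -/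
def psi {n : ℕ} (p : ℝ) : Euc n → ℝ := symLap p profile

/-- The gradient of `psi`. -/
def dpsi {n : ℕ} (p : ℝ) : Euc n → Euc n →L[ℝ] ℝ := symLap p (fderiv ℝ profile)

lemma hasFDerivAt_psi (hn : 1 ≤ n) (hp : n < p) (hp2 : p < n + 2) (x : Euc n) :
    HasFDerivAt (psi p) (dpsi p x) x :=
  hasFDerivAt_symLap hn hp hp2 (contDiff_profile.of_le (by norm_num)) hasCompactSupport_profile x

lemma exists_abs_psi_le (hn : 1 ≤ n) (hp : n < p) (hp2 : p < n + 2) :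
    ∃ C, 0 ≤ C ∧ ∀ x : Euc n, |psi p x| ≤ C * decay p x :=
  exists_norm_symLap_le hn hp hp2 (contDiff_profile.of_le (by norm_num)) hasCompactSupport_profile

lemma contDiff_fderiv_profile : ContDiff ℝ 3 (fderiv ℝ (profile : Euc n → ℝ)) :=
  contDiff_profile.fderiv_right (by norm_num)

lemma exists_norm_dpsi_le (hn : 1 ≤ n) (hp : n < p) (hp2 : p < n + 2) :
    ∃ C, 0 ≤ C ∧ ∀ x : Euc n, ‖dpsi p x‖ ≤ C * decay p x :=
  exists_norm_symLap_le hn hp hp2 (contDiff_fderiv_profile.of_le (by norm_num))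
    (hasCompactSupport_profile.fderiv ℝ)

lemma exists_norm_dpsi_sub_le (hn : 1 ≤ n) (hp : n < p) (hp2 : p < n + 2) :
    ∃ C, 0 ≤ C ∧ ∀ a b : Euc n, ‖a - b‖ ≤ 1 →
      ‖dpsi p a - dpsi p b‖ ≤ C * decay p a * ‖a - b‖ := by
  have hp0 : 0 < p := (Nat.cast_nonneg n).trans_lt hp
  obtain ⟨C, h0, hC⟩ := exists_norm_symLap_le hn hp hp2
    (f := fderiv ℝ (fderiv ℝ (profile : Euc n → ℝ)))
    (contDiff_fderiv_profile.fderiv_right (by norm_num))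
    ((hasCompactSupport_profile.fderiv ℝ).fderiv ℝ)
  exact ⟨C * 2 ^ p, by positivity, fun a b hab => norm_sub_le_decay_mul hp0
    (fun x => hasFDerivAt_symLap hn hp hp2 contDiff_fderiv_profile
      (hasCompactSupport_profile.fderiv ℝ) x) h0 hC hab⟩

lemma continuous_psi (hn : 1 ≤ n) (hp : n < p) (hp2 : p < n + 2) :
    Continuous (psi p : Euc n → ℝ) :=
  continuous_iff_continuousAt.2 fun x => (hasFDerivAt_psi hn hp hp2 x).continuousAt

lemma continuous_dpsi (hn : 1 ≤ n) (hp : n < p) (hp2 : p < n + 2) :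
    Continuous (dpsi p : Euc n → Euc n →L[ℝ] ℝ) :=
  continuous_iff_continuousAt.2 fun x => (hasFDerivAt_symLap hn hp hp2 contDiff_fderiv_profile
      (hasCompactSupport_profile.fderiv ℝ) x).continuousAt

lemma psi_eq_of_norm_eq {x y : Euc n} (h : ‖x‖ = ‖y‖) : psi p x = psi p y :=
  symLap_eq_of_norm_eq (fun _ _ => profile_eq_of_norm_eq) h

lemma integral_psi (hn : 1 ≤ n) (hp : n < p) (hp2 : p < n + 2) :
    ∫ x : Euc n, psi p x = 0 := by
  have := (tame_const hp (1 : ℝ)).integral_symLap_mul hn hp hp2 (Θ := (profile : Euc n → ℝ))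
    (contDiff_profile.of_le (by norm_num)) hasCompactSupport_profile
  simpa [symLap_const, psi] using this

/-- The averaged kernel `∫₀¹ τ^{n-1} ψ(τ y) dτ`. -/
def avgKer {n : ℕ} (p : ℝ) (y : Euc n) : ℝ := ∫ τ in (0 : ℝ)..1, τ ^ (n - 1) * psi p (τ • y)

/-- The gradient of the averaged kernel. -/
def davgKer {n : ℕ} (p : ℝ) (y : Euc n) : Euc n →L[ℝ] ℝ :=
  ∫ τ in (0 : ℝ)..1, τ ^ n • dpsi p (τ • y)

lemma hasFDerivAt_avgKer (hn : 1 ≤ n) (hp : n < p) (hp2 : p < n + 2) (y : Euc n) :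
    HasFDerivAt (avgKer p) (davgKer p y) y := by
  have hp0 : 0 < p := (Nat.cast_nonneg n).trans_lt hp
  have hψ := continuous_psi hn hp hp2
  have hdψ := continuous_dpsi hn hp hp2
  obtain ⟨C, h0, hC⟩ := exists_norm_dpsi_le hn hp hp2
  refine (intervalIntegral.hasFDerivAt_integral_of_dominated_of_fderiv_le (𝕜 := ℝ)
    (F := fun y τ => τ ^ (n - 1) * psi p (τ • y)) (F' := fun y τ => τ ^ n • dpsi p (τ • y))
    (bound := fun _ => C) (univ_mem : univ ∈ 𝓝 y) ?_ ?_ ?_ ?_ ?_ ?_)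
  · exact Eventually.of_forall fun z =>
      (by fun_prop : Continuous fun τ : ℝ => τ ^ (n - 1) * psi p (τ • z)).aestronglyMeasurable
  · exact (by fun_prop : Continuous fun τ : ℝ => τ ^ (n - 1) * psi p (τ • y)).intervalIntegrable _ _
  · exact (by fun_prop : Continuous fun τ : ℝ => τ ^ n • dpsi p (τ • y)).aestronglyMeasurable
  · refine Eventually.of_forall fun τ hτ z _ => ?_
    rw [uIoc_of_le zero_le_one] at hτ
    rw [norm_smul, norm_pow, Real.norm_of_nonneg hτ.1.le]
    have h1 : τ ^ n ≤ 1 := pow_le_one₀ hτ.1.le hτ.2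
    have h2 : ‖dpsi p (τ • z)‖ ≤ C := (hC _).trans (mul_le_of_le_one_right h0 (decay_le_one hp0 _))
    nlinarith [norm_nonneg (dpsi p (τ • z)), pow_nonneg hτ.1.le n]
  · exact intervalIntegrable_const
  · refine Eventually.of_forall fun τ _ z _ => ?_
    have h1 : HasFDerivAt (fun z : Euc n => τ • z) (τ • ContinuousLinearMap.id ℝ (Euc n)) z :=
      (hasFDerivAt_id z).const_smul τ
    have h2 := ((hasFDerivAt_psi hn hp hp2 (τ • z)).comp z h1).const_mul (τ ^ (n - 1))
    refine h2.congr_fderiv (ContinuousLinearMap.ext fun v => ?_)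
    simp only [smul_apply, ContinuousLinearMap.comp_apply,
      ContinuousLinearMap.id_apply, map_smul, smul_eq_mul]
    rw [← mul_assoc, ← pow_succ, Nat.sub_add_cancel hn]

lemma continuous_avgKer (hn : 1 ≤ n) (hp : n < p) (hp2 : p < n + 2) :
    Continuous (avgKer p : Euc n → ℝ) :=
  continuous_iff_continuousAt.2 fun x => (hasFDerivAt_avgKer hn hp hp2 x).continuousAt

lemma exists_norm_davgKer_sub_le (hn : 1 ≤ n) (hp : n < p) (hp2 : p < n + 2) :
    ∃ C, 0 ≤ C ∧ ∀ a b : Euc n, ‖a - b‖ ≤ 1 →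
      ‖davgKer p a - davgKer p b‖ ≤ C * decay p a * ‖a - b‖ := by
  have hp0 : 0 < p := (Nat.cast_nonneg n).trans_lt hp
  have hdψ := continuous_dpsi hn hp hp2
  obtain ⟨C, h0, hC⟩ := exists_norm_dpsi_sub_le hn hp hp2
  have hi : IntervalIntegrable (fun τ : ℝ => τ ^ ((n : ℝ) + 1 - p)) volume 0 1 :=
    intervalIntegral.intervalIntegrable_rpow' (by linarith)
  have hI : 0 ≤ ∫ τ in (0 : ℝ)..1, τ ^ ((n : ℝ) + 1 - p) :=
    intervalIntegral.integral_nonneg zero_le_one fun τ hτ => Real.rpow_nonneg hτ.1 _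
  refine ⟨C * ∫ τ in (0 : ℝ)..1, τ ^ ((n : ℝ) + 1 - p), by positivity, fun a b hab => ?_⟩
  unfold davgKer
  have hc : ∀ z : Euc n, Continuous fun τ : ℝ => τ ^ n • dpsi p (τ • z) := fun z => by fun_prop
  rw [← intervalIntegral.integral_sub ((hc a).intervalIntegrable _ _)
    ((hc b).intervalIntegrable _ _)]
  refine (intervalIntegral.norm_integral_le_of_norm_le (g := fun τ =>
    C * decay p a * ‖a - b‖ * τ ^ ((n : ℝ) + 1 - p)) zero_le_one ?_ (hi.const_mul _)).trans_eq ?_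
  · refine Eventually.of_forall fun τ hτ => ?_
    rw [(smul_sub (τ ^ n) (dpsi p (τ • a)) (dpsi p (τ • b))).symm, norm_smul, norm_pow,
      Real.norm_of_nonneg hτ.1.le]
    have hn1 : ‖τ • a - τ • b‖ = τ * ‖a - b‖ := by
      rw [← smul_sub, norm_smul, Real.norm_of_nonneg hτ.1.le]
    have h1 := hC (τ • a) (τ • b) (by rw [hn1]; nlinarith [norm_nonneg (a - b), hτ.1, hτ.2])
    have h2 := decay_smul_le hp0 hτ.1 hτ.2 a
    have hpw : τ ^ ((n : ℝ) + 1 - p) = τ ^ n * τ * τ ^ (-p) := by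
      rw [← Real.rpow_natCast τ n, ← Real.rpow_add_one hτ.1.ne', ← Real.rpow_add hτ.1]
      ring_nf
    have hτ0 := hτ.1
    calc τ ^ n * ‖dpsi p (τ • a) - dpsi p (τ • b)‖
        ≤ τ ^ n * (C * (τ ^ (-p) * decay p a) * (τ * ‖a - b‖)) := by
          rw [hn1] at h1
          refine mul_le_mul_of_nonneg_left (h1.trans ?_) (by positivity)
          gcongr
      _ = _ := by rw [hpw]; ring
  · rw [intervalIntegral.integral_const_mul]; ring

lemma exists_abs_avgKer_le (hn : 1 ≤ n) (hp : n < p) (hp2 : p < n + 2) :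
    ∃ C, 0 ≤ C ∧ ∀ y : Euc n, |avgKer p y| ≤ C * decay p y := by
  have hp0 : 0 < p := (Nat.cast_nonneg n).trans_lt hp
  have hψ := continuous_psi hn hp hp2
  obtain ⟨C, h0, hC⟩ := exists_abs_psi_le hn hp hp2
  have : Nontrivial (Euc n) := by
    have : Nonempty (Fin n) := ⟨⟨0, hn⟩⟩
    infer_instance
  obtain ⟨e, he⟩ : ∃ e : Euc n, ‖e‖ = 1 := exists_norm_eq _ zero_le_one
  set F : ℝ → ℝ := fun t => t ^ (n - 1) * psi p (t • e) with hF
  have hFc : Continuous F := by fun_prop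
  have hFb : ∀ t, 0 < t → |F t| ≤ C * t ^ ((n : ℝ) - 1 - p) := by
    intro t ht
    have h1 : decay p (t • e) ≤ t ^ (-p) := by
      refine (decay_le_singKer hp0 ?_).trans_eq ?_
      · exact smul_ne_zero ht.ne' (norm_ne_zero_iff.1 (by rw [he]; exact one_ne_zero))
      · simp [singKer, norm_smul, he, abs_of_pos ht]
    have h2 : t ^ ((n : ℝ) - 1 - p) = t ^ (n - 1) * t ^ (-p) := by
      rw [← Real.rpow_natCast, ← Real.rpow_add ht, Nat.cast_sub hn, Nat.cast_one]; ring_nf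
    rw [hF, h2]
    dsimp only
    rw [abs_mul, abs_of_pos (by positivity : 0 < t ^ (n - 1))]
    have := (hC (t • e)).trans (mul_le_mul_of_nonneg_left h1 h0)
    nlinarith [pow_pos ht (n - 1)]
  have hInt : ∀ r : ℝ, 0 < r → IntegrableOn (fun t : ℝ => C * t ^ ((n : ℝ) - 1 - p)) (Ioi r) :=
    fun r hr => (integrableOn_Ioi_rpow_of_lt (by linarith) hr).const_mul C
  have hFi : ∀ r : ℝ, 0 < r → IntegrableOn F (Ioi r) := fun r hr =>
    (hInt r hr).mono' hFc.aestronglyMeasurable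
      ((ae_restrict_iff' measurableSet_Ioi).2
        (Eventually.of_forall fun t ht => hFb t (hr.trans ht)))
  have hFi0 : IntegrableOn F (Ioi 0) := by
    rw [← Ioc_union_Ioi_eq_Ioi zero_le_one]
    exact (hFc.integrableOn_Ioc).union (hFi 1 one_pos)
  have hzero : ∫ t in Ioi (0 : ℝ), F t = 0 := by
    have h := integral_fun_norm_addHaar (volume : Measure (Euc n)) (fun t => psi p (t • e))
    have h' : ∫ x : Euc n, psi p (‖x‖ • e) = 0 := by
      rw [← integral_psi hn hp hp2]
      refine integral_congr_ae (Eventually.of_forall fun x => psi_eq_of_norm_eq ?_)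
      simp [norm_smul, he]
    rw [h', finrank_euclideanSpace_fin] at h
    have hb : 0 < (volume : Measure (Euc n)).real (ball 0 1) :=
      ENNReal.toReal_pos (measure_ball_pos _ _ one_pos).ne' measure_ball_lt_top.ne
    have hn' : (n : ℝ) ≠ 0 := by positivity
    simp only [nsmul_eq_mul, smul_eq_mul] at h
    rcases mul_eq_zero.1 h.symm with h | h
    · exact absurd h hn'
    · exact (mul_eq_zero.1 h).resolve_left hb.ne'
  have hlarge : ∀ y : Euc n, 1 ≤ ‖y‖ → |avgKer p y| ≤ C / (p - n) * singKer p y := by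
    intro y hy
    have hr : 0 < ‖y‖ := by linarith
    have e1 : avgKer p y = (‖y‖ ^ n)⁻¹ * ∫ t in (0 : ℝ)..‖y‖, F t := by
      have h := intervalIntegral.integral_comp_mul_right (a := 0) (b := 1) F hr.ne'
      rw [zero_mul, one_mul] at h
      have h3 : ∀ τ ∈ uIcc (0 : ℝ) 1, F (τ * ‖y‖) =
          ‖y‖ ^ (n - 1) * (τ ^ (n - 1) * psi p (τ • y)) := by
        intro τ _
        simp only [hF, mul_pow]
        rw [psi_eq_of_norm_eq (x := (τ * ‖y‖) • e) (y := τ • y) (by simp [norm_smul, he])]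
        ring
      rw [intervalIntegral.integral_congr h3, intervalIntegral.integral_const_mul] at h
      have h4 : ‖y‖ ^ n = ‖y‖ ^ (n - 1) * ‖y‖ := by
        rw [← pow_succ, Nat.sub_add_cancel hn]
      have h5 : 0 < ‖y‖ ^ (n - 1) := by positivity
      rw [h4, mul_inv, mul_assoc, ← smul_eq_mul (‖y‖⁻¹), ← h]
      unfold avgKer
      field_simp
    have e2 : ∫ t in (0 : ℝ)..‖y‖, F t = - ∫ t in Ioi ‖y‖, F t := by
      have h := intervalIntegral.integral_interval_add_Ioi hFi0 (hFi _ hr)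
      rw [hzero] at h; linarith
    have e3 : |∫ t in Ioi ‖y‖, F t| ≤ C * (‖y‖ ^ ((n : ℝ) - p) / (p - n)) := by
      refine (norm_integral_le_of_norm_le (hInt _ hr) ((ae_restrict_iff' measurableSet_Ioi).2
        (Eventually.of_forall fun t ht => (Real.norm_eq_abs _).trans_le
          (hFb t (hr.trans ht))))).trans_eq ?_
      rw [integral_const_mul, integral_Ioi_rpow_of_lt (by linarith) hr]
      have h6 : (n : ℝ) - 1 - p + 1 = n - p := by ring
      rw [h6, ← neg_sub p n, div_neg, neg_div, neg_neg]
    rw [e1, e2, abs_mul, abs_neg, abs_of_pos (by positivity)]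
    refine (mul_le_mul_of_nonneg_left e3 (by positivity)).trans_eq ?_
    rw [Real.rpow_sub hr, Real.rpow_natCast, singKer, Real.rpow_neg hr.le]
    field_simp
  have hpn : 0 < p - n := by linarith
  refine ⟨C * 2 ^ p + C / (p - n) * 2 ^ p, by positivity, fun y => ?_⟩
  have hdp := decay_pos (p := p) y
  rcases le_or_gt 1 ‖y‖ with hy | hy
  · have h1 := singKer_le_decay hp0 hy
    calc _ ≤ C / (p - n) * (2 ^ p * decay p y) :=
          (hlarge y hy).trans (mul_le_mul_of_nonneg_left h1 (by positivity))
      _ ≤ _ := by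
          have : 0 ≤ C * 2 ^ p * decay p y := by positivity
          linarith
  · have h1 : |avgKer p y| ≤ C := by
      have h := intervalIntegral.norm_integral_le_of_norm_le_const (a := 0) (b := 1) (C := C)
        (f := fun τ : ℝ => τ ^ (n - 1) * psi p (τ • y)) (fun τ hτ => ?_)
      · simpa [avgKer] using h
      · rw [uIoc_of_le zero_le_one] at hτ
        rw [norm_mul, norm_pow, Real.norm_of_nonneg hτ.1.le, Real.norm_eq_abs]
        have h1 : τ ^ (n - 1) ≤ 1 := pow_le_one₀ hτ.1.le hτ.2
        have h2 := (hC (τ • y)).trans (mul_le_of_le_one_right h0 (decay_le_one hp0 _))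
        nlinarith [abs_nonneg (psi p (τ • y)), pow_nonneg hτ.1.le (n - 1)]
    have h2 := one_le_decay (p := p) hp0 hy.le
    norm_num at h2
    calc _ ≤ C * (2 ^ p * decay p y) := h1.trans (le_mul_of_one_le_right h0 h2)
      _ ≤ _ := by
          have : 0 ≤ C / (p - n) * 2 ^ p * decay p y := by positivity
          linarith

lemma exists_norm_davgKer_le (hn : 1 ≤ n) (hp : n < p) (hp2 : p < n + 2) :
    ∃ C, 0 ≤ C ∧ ∀ y : Euc n, ‖davgKer p y‖ ≤ C * decay p y := by
  have hp0 : 0 < p := (Nat.cast_nonneg n).trans_lt hp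
  obtain ⟨A, hA0, hA⟩ := exists_abs_avgKer_le hn hp hp2
  obtain ⟨L, hL0, hL⟩ := exists_norm_davgKer_sub_le hn hp hp2
  have hb : ∀ y v : Euc n, ‖v‖ = 1 → ‖davgKer p y v‖ ≤ (L + A * 2 ^ p + A) * decay p y := by
    intro y v hv
    have hd := decay_pos (p := p) y
    have h1 := (convex_closedBall y 1).norm_image_sub_le_of_norm_hasFDerivWithin_le'
      (f := avgKer p) (f' := davgKer p) (φ := davgKer p y) (C := L * decay p y)
      (fun x _ => (hasFDerivAt_avgKer hn hp hp2 x).hasFDerivWithinAt)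
      (fun x hx => ?_) (mem_closedBall_self zero_le_one)
      (y := y + v) (by simp [hv])
    · rw [add_sub_cancel_left, hv, mul_one] at h1
      have h2 : decay p (y + v) ≤ 2 ^ p * decay p y := by
        have := decay_le_of_norm_le hp0 (x := y + v) (y := -v) (R := 1) (by simp [hv])
        norm_num at this; exact this
      have h3 := hA (y + v)
      have h4 := hA y
      have h5 : ‖davgKer p y v‖ ≤ ‖avgKer p (y + v) - avgKer p y - davgKer p y v‖ +
          (|avgKer p (y + v)| + |avgKer p y|) := by
        simp only [Real.norm_eq_abs]
        have t1 := neg_abs_le (avgKer p (y + v) - avgKer p y - davgKer p y v)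
        have t2 := le_abs_self (avgKer p (y + v) - avgKer p y - davgKer p y v)
        have t3 := abs_le.1 (le_refl |avgKer p (y + v)|)
        have t4 := abs_le.1 (le_refl |avgKer p y|)
        exact abs_le.2 ⟨by linarith, by linarith⟩
      nlinarith [mul_le_mul_of_nonneg_left h2 hA0]
    · rw [mem_closedBall, dist_eq_norm] at hx
      rw [norm_sub_rev]
      refine (hL y x (by rwa [norm_sub_rev])).trans ?_
      rw [norm_sub_rev]
      exact mul_le_of_le_one_right (by positivity) hx
  refine ⟨L + A * 2 ^ p + A, by positivity, fun y => ?_⟩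
  have hd := decay_pos (p := p) y
  refine ContinuousLinearMap.opNorm_le_of_unit_norm (by positivity) (hb y)

end Averaging

section ScaledIntegrals

variable {n : ℕ} {E : Type*} [NormedAddCommGroup E] [NormedSpace ℝ E]

/-- The integral of `h` against the rescaled kernel `Φ(τ(z - x))`. -/
def scaledInt (Φ : Euc n → E) (h : Euc n → ℝ) (x : Euc n) (τ : ℝ) : E :=
  ∫ z, h z • Φ (τ • (z - x))

lemma integral_comp_smul_sub {τ : ℝ} (hτ : 0 < τ) (f : Euc n → E) (x : Euc n) :
    ∫ z, f (τ • (z - x)) = (τ ^ n)⁻¹ • ∫ y, f y := by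
  rw [integral_sub_right_eq_self (fun z => f (τ • z)) x, Measure.integral_comp_smul,
    finrank_euclideanSpace_fin, abs_of_pos (by positivity)]

omit [NormedSpace ℝ E] in
lemma Integrable.comp_smul_sub {τ : ℝ} (hτ : 0 < τ) {f : Euc n → E} (hf : Integrable f)
    (x : Euc n) : Integrable fun z => f (τ • (z - x)) :=
  (hf.comp_smul hτ.ne').comp_sub_right x

lemma scaledInt_congr {Φ : Euc n → E} {h h' : Euc n → ℝ} {x : Euc n} {τ : ℝ} (hτ : 1 ≤ τ)
    (hΦ : ∀ y, 1 / 4 ≤ ‖y‖ → Φ y = 0) (hh : ∀ z ∈ ball x (1 / 4), h z = h' z) :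
    scaledInt Φ h x τ = scaledInt Φ h' x τ := by
  refine integral_congr_ae (Eventually.of_forall fun z => ?_)
  by_cases hz : z ∈ ball x (1 / 4)
  · simp only [hh z hz]
  · have : 1 / 4 ≤ ‖τ • (z - x)‖ := by
      rw [mem_ball, dist_eq_norm, not_lt] at hz
      rw [norm_smul, Real.norm_of_nonneg (by linarith)]
      nlinarith
    simp [hΦ _ this]

lemma norm_scaledInt_le {Φ : Euc n → E} (hΦ : Integrable Φ) {h : Euc n → ℝ} {H : ℝ}
    (hh : ∀ z, |h z| ≤ H) (x : Euc n) {τ : ℝ} (hτ : 0 < τ) :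
    ‖scaledInt Φ h x τ‖ ≤ H * (τ ^ n)⁻¹ * ∫ y, ‖Φ y‖ := by
  refine (norm_integral_le_of_norm_le (((Integrable.comp_smul_sub hτ hΦ x).norm).const_mul H)
    (Eventually.of_forall fun z => ?_)).trans_eq ?_
  · rw [norm_smul]
    exact mul_le_mul_of_nonneg_right (hh z) (norm_nonneg _)
  · rw [integral_const_mul, integral_comp_smul_sub hτ (fun y => ‖Φ y‖), smul_eq_mul, mul_assoc]

lemma stronglyMeasurable_scaledInt {Φ : Euc n → E} (hΦ : Continuous Φ) {h : Euc n → ℝ}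
    (hh : Measurable h) (x : Euc n) : StronglyMeasurable (scaledInt Φ h x) := by
  refine StronglyMeasurable.integral_prod_right'
    (f := fun q : ℝ × Euc n => h q.2 • Φ (q.1 • (q.2 - x))) ?_
  exact (hh.comp measurable_snd).stronglyMeasurable.smul
    (hΦ.comp (by fun_prop)).stronglyMeasurable

end ScaledIntegrals

section Representation

variable {n : ℕ} {p : ℝ} {u : Euc n → ℝ}

lemma Tame.integrable_decay_translate (hp : 0 < p) (hu : Tame p u) (x : Euc n) :
    Integrable fun y => decay p y * |u (x + y)| := by
  have h := (hu.integrable_abs.comp_add_left x).const_mul ((1 + ‖x‖) ^ p)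
  refine h.mono' (continuous_decay.mul (by have := hu.continuous; fun_prop)).aestronglyMeasurable
    (Eventually.of_forall fun y => ?_)
  rw [Real.norm_of_nonneg (mul_nonneg (decay_pos _).le (abs_nonneg _)), ← mul_assoc]
  have := decay_le_add hp y x
  rw [add_comm y x] at this
  exact mul_le_mul_of_nonneg_right this (abs_nonneg _)

lemma Tame.integral_psi_smul (hn : 1 ≤ n) (hp : n < p) (hp2 : p < n + 2) (hu : Tame p u)
    (x : Euc n) {τ : ℝ} (hτ : 0 < τ) :
    ∫ y, psi p (τ • y) * u (x + y) = τ ^ ((n : ℝ) - p) * scaledInt profile (symLap p u) x τ := by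
  have hd : ContDiff ℝ 2 fun z : Euc n => τ • (z - x) :=
    (contDiff_id.sub contDiff_const).const_smul τ
  have hΘ : ContDiff ℝ 2 fun z : Euc n => profile (τ • (z - x)) :=
    (contDiff_profile.of_le (by norm_num)).comp hd
  have hs : HasCompactSupport fun z : Euc n => profile (τ • (z - x)) :=
    hasCompactSupport_profile.comp_homeomorph
      ((Homeomorph.subRight x).trans (Homeomorph.smulOfNeZero τ hτ.ne'))
  have h := hu.integral_symLap_mul hn hp hp2 hΘ hs
  simp_rw [symLap_comp_smul_sub hτ] at h
  rw [← integral_add_left_eq_self _ x] at h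
  simp only [add_sub_cancel_left, smul_eq_mul, mul_assoc] at h
  rw [integral_const_mul] at h
  have e : scaledInt profile (symLap p u) x τ = ∫ z, profile (τ • (z - x)) * symLap p u z := by
    simp only [scaledInt, smul_eq_mul, mul_comm]
  rw [e, ← h, ← mul_assoc, ← Real.rpow_add hτ]
  simp [psi]

lemma avgKer_scale (hn : 1 ≤ n) {T : ℝ} (hT : 0 < T) (y : Euc n) :
    T ^ n * avgKer p (T • y) = ∫ τ in (0 : ℝ)..T, τ ^ (n - 1) * psi p (τ • y) := by
  have h := intervalIntegral.integral_comp_mul_right (a := 0) (b := 1)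
    (fun τ => τ ^ (n - 1) * psi p (τ • y)) hT.ne'
  rw [zero_mul, one_mul, smul_eq_mul, eq_inv_mul_iff_mul_eq₀ hT.ne'] at h
  have hTn : T ^ n = T * T ^ (n - 1) := by rw [← pow_succ', Nat.sub_add_cancel hn]
  rw [← h, avgKer, hTn, mul_assoc, ← intervalIntegral.integral_const_mul]
  congr 2
  ext τ
  rw [mul_pow, smul_smul]; ring

lemma Tame.integrable_avgKer_mul (hn : 1 ≤ n) (hp : n < p) (hp2 : p < n + 2) (hu : Tame p u)
    (x : Euc n) {T : ℝ} (hT : 1 ≤ T) : Integrable fun y => avgKer p (T • y) * u (x + y) := by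
  have hp0 : 0 < p := (Nat.cast_nonneg n).trans_lt hp
  obtain ⟨C, h0, hC⟩ := exists_abs_avgKer_le hn hp hp2
  have hc := continuous_avgKer hn hp hp2
  have hu' := hu.continuous
  refine ((hu.integrable_decay_translate hp0 x).const_mul C).mono'
    (by fun_prop : Continuous fun y => avgKer p (T • y) * u (x + y)).aestronglyMeasurable
    (Eventually.of_forall fun y => ?_)
  rw [norm_mul, ← mul_assoc]
  exact mul_le_mul_of_nonneg_right ((hC _).trans
    (mul_le_mul_of_nonneg_left (decay_smul_le_of_one_le hp0 hT y) h0)) (norm_nonneg _)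

lemma Tame.integral_avgKer_sub (hn : 1 ≤ n) (hp : n < p) (hp2 : p < n + 2) (hu : Tame p u)
    (x : Euc n) {T : ℝ} (hT : 1 ≤ T) :
    T ^ n * (∫ y, avgKer p (T • y) * u (x + y)) - ∫ y, avgKer p y * u (x + y) =
      ∫ τ in (1 : ℝ)..T, τ ^ (n - 1) * ∫ y, psi p (τ • y) * u (x + y) := by
  have hp0 : 0 < p := (Nat.cast_nonneg n).trans_lt hp
  have hT0 : 0 < T := by linarith
  have hψ := continuous_psi hn hp hp2
  have hu' := hu.continuous
  obtain ⟨C, h0, hC⟩ := exists_abs_psi_le hn hp hp2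
  have hF : Integrable (Function.uncurry fun (τ : ℝ) (y : Euc n) =>
      τ ^ (n - 1) * (psi p (τ • y) * u (x + y))) ((volume.restrict (Ioc 1 T)).prod volume) := by
    have hdom : Integrable (fun z : ℝ × Euc n => T ^ (n - 1) * C *
        (decay p z.2 * |u (x + z.2)|)) ((volume.restrict (Ioc 1 T)).prod volume) :=
      (integrable_const (μ := volume.restrict (Ioc (1 : ℝ) T)) (T ^ (n - 1) * C)).mul_prod
        (hu.integrable_decay_translate hp0 x)
    have hcont : Continuous (Function.uncurry fun (τ : ℝ) (y : Euc n) =>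
        τ ^ (n - 1) * (psi p (τ • y) * u (x + y))) := by
      unfold Function.uncurry; fun_prop
    refine hdom.mono' hcont.aestronglyMeasurable ?_
    have hae : ∀ᵐ z : ℝ × Euc n ∂((volume.restrict (Ioc 1 T)).prod volume), z.1 ∈ Ioc 1 T :=
      Measure.quasiMeasurePreserving_fst.ae (ae_restrict_mem measurableSet_Ioc)
    filter_upwards [hae] with z hz
    have hz0 : 0 ≤ z.1 := by linarith [hz.1]
    simp only [Function.uncurry, norm_mul, norm_pow, Real.norm_eq_abs, abs_of_nonneg hz0]
    have h1 : z.1 ^ (n - 1) ≤ T ^ (n - 1) := pow_le_pow_left₀ hz0 hz.2 _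
    have h2 := (hC (z.1 • z.2)).trans
      (mul_le_mul_of_nonneg_left (decay_smul_le_of_one_le hp0 hz.1.le z.2) h0)
    calc _ ≤ T ^ (n - 1) * (C * decay p z.2 * |u (x + z.2)|) := by
          have := decay_pos (p := p) z.2
          gcongr
      _ = _ := by ring
  have hswap : ∫ τ in (1 : ℝ)..T, τ ^ (n - 1) * ∫ y, psi p (τ • y) * u (x + y) =
      ∫ y, ∫ τ in (1 : ℝ)..T, τ ^ (n - 1) * (psi p (τ • y) * u (x + y)) := by
    simp_rw [intervalIntegral.integral_of_le hT, ← integral_const_mul]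
    exact integral_integral_swap hF
  rw [hswap, ← integral_const_mul, ← integral_sub]
  · refine integral_congr_ae (Eventually.of_forall fun y => ?_)
    have hc : Continuous fun τ : ℝ => τ ^ (n - 1) * psi p (τ • y) := by fun_prop
    dsimp only
    simp_rw [← mul_assoc]
    rw [intervalIntegral.integral_mul_const, avgKer_scale hn hT0, ← sub_mul, avgKer,
      intervalIntegral.integral_interval_sub_left (hc.intervalIntegrable _ _)
        (hc.intervalIntegrable _ _)]
  · exact (hu.integrable_avgKer_mul hn hp hp2 x hT).const_mul _
  · simpa using hu.integrable_avgKer_mul hn hp hp2 x le_rfl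

lemma integrable_avgKer (hn : 1 ≤ n) (hp : n < p) (hp2 : p < n + 2) :
    Integrable (avgKer p : Euc n → ℝ) := by
  obtain ⟨C, h0, hC⟩ := exists_abs_avgKer_le hn hp hp2
  exact ((integrable_decay hp).const_mul C).mono'
    (continuous_avgKer hn hp hp2).aestronglyMeasurable (Eventually.of_forall hC)

lemma Tame.tendsto_integral_avgKer (hn : 1 ≤ n) (hp : n < p) (hp2 : p < n + 2) (hu : Tame p u)
    (x : Euc n) : Tendsto (fun T : ℝ => T ^ n * ∫ y, avgKer p (T • y) * u (x + y)) atTop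
      (𝓝 ((∫ y : Euc n, avgKer p y) * u x)) := by
  have hp0 : 0 < p := (Nat.cast_nonneg n).trans_lt hp
  obtain ⟨C, h0, hC⟩ := exists_abs_avgKer_le hn hp hp2
  have hK := continuous_avgKer hn hp hp2
  have hKi := integrable_avgKer hn hp hp2
  have hu' := hu.continuous
  have hux : Continuous fun y => u (x + y) := by fun_prop
  classical
  set B : Set (Euc n) := closedBall 0 1
  have hB : MeasurableSet B := measurableSet_closedBall
  set v : Euc n → ℝ := B.indicator fun y => u (x + y) with hv
  set w : Euc n → ℝ := Bᶜ.indicator fun y => u (x + y) with hw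
  have hvm : Measurable v := hux.measurable.indicator hB
  have hwm : Measurable w := hux.measurable.indicator hB.compl
  have hvw : ∀ y, u (x + y) = v y + w y := fun y =>
    (congrFun (indicator_self_add_compl B fun y => u (x + y)) y).symm
  have hInt : ∀ T : ℝ, 1 ≤ T → Integrable (fun y => avgKer p (T • y) * v y) ∧
      Integrable (fun y => avgKer p (T • y) * w y) := by
    intro T hT
    have h := hu.integrable_avgKer_mul hn hp hp2 x hT
    refine ⟨(h.indicator hB).congr (Eventually.of_forall fun y => ?_),
      (h.indicator hB.compl).congr (Eventually.of_forall fun y => ?_)⟩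
    · simp only [hv, indicator_apply]; split_ifs <;> simp
    · simp only [hw, indicator_apply]; split_ifs <;> simp
  have hnear : Tendsto (fun T : ℝ => T ^ n * ∫ y, avgKer p (T • y) * v y) atTop
      (𝓝 ((∫ y : Euc n, avgKer p y) * u x)) := by
    obtain ⟨M, hM0, hM⟩ := hu.exists_bound (‖x‖ + 1)
    have hvb : ∀ y, |v y| ≤ M := by
      intro y
      simp only [hv, indicator_apply]
      split_ifs with hy
      · exact hM _ ((norm_add_le _ _).trans (by
          have := mem_closedBall_zero_iff.1 hy; linarith))
      · simpa using hM0
    have hv0 : Tendsto v (𝓝 0) (𝓝 (u x)) := by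
      have h1 : Tendsto (fun y => u (x + y)) (𝓝 0) (𝓝 (u x)) := by
        simpa using hux.tendsto 0
      refine h1.congr' ?_
      filter_upwards [closedBall_mem_nhds (0 : Euc n) one_pos] with y hy
      simp [hv, B, indicator_of_mem hy]
    have hlim : Tendsto (fun T : ℝ => ∫ y, avgKer p y * v (T⁻¹ • y)) atTop
        (𝓝 (∫ y : Euc n, avgKer p y * u x)) := by
      refine tendsto_integral_filter_of_dominated_convergence (fun y => |avgKer p y| * M)
        (Eventually.of_forall fun T => ?_) (Eventually.of_forall fun T =>
          Eventually.of_forall fun y => ?_) (hKi.abs.mul_const M) (Eventually.of_forall fun y => ?_)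
      · exact (hK.measurable.mul (hvm.comp (measurable_const_smul _))).aestronglyMeasurable
      · rw [norm_mul]
        exact mul_le_mul_of_nonneg_left (hvb _) (norm_nonneg _)
      · refine tendsto_const_nhds.mul (hv0.comp ?_)
        simpa using (tendsto_inv_atTop_zero (𝕜 := ℝ)).smul_const y
    rw [integral_mul_const] at hlim
    refine hlim.congr' ?_
    filter_upwards [eventually_gt_atTop 0] with T hT
    have h := integral_comp_smul_sub hT (fun y => avgKer p y * v (T⁻¹ • y)) 0
    simp only [sub_zero, smul_smul, inv_mul_cancel₀ hT.ne', one_smul] at h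
    rw [h, smul_eq_mul, mul_inv_cancel_left₀ (by positivity)]
  have hfar : Tendsto (fun T : ℝ => T ^ n * ∫ y, avgKer p (T • y) * w y) atTop (𝓝 0) := by
    set I := ∫ y, decay p y * |u (x + y)|
    have hlim : Tendsto (fun T : ℝ => C * 2 ^ p * I * T ^ (-(p - n))) atTop (𝓝 0) := by
      simpa using (tendsto_rpow_neg_atTop (sub_pos.2 hp)).const_mul (C * 2 ^ p * I)
    refine squeeze_zero_norm' ?_ hlim
    filter_upwards [eventually_ge_atTop 1] with T hT
    have hT0 : 0 < T := by linarith
    have h1 : ‖∫ y, avgKer p (T • y) * w y‖ ≤ ∫ y, C * T ^ (-p) * 2 ^ p *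
        (decay p y * |u (x + y)|) := by
      refine norm_integral_le_of_norm_le
        ((hu.integrable_decay_translate hp0 x).const_mul _) (Eventually.of_forall fun y => ?_)
      have hd := decay_pos (p := p) y
      simp only [hw, indicator_apply]
      split_ifs with hy
      · have hy1 : 1 ≤ ‖y‖ := by
          rw [mem_compl_iff, mem_closedBall_zero_iff, not_le] at hy; exact hy.le
        have hy0 : y ≠ 0 := norm_pos_iff.1 (by linarith)
        have h2 : |avgKer p (T • y)| ≤ C * (T ^ (-p) * (2 ^ p * decay p y)) := by
          refine (hC _).trans (mul_le_mul_of_nonneg_left ?_ h0)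
          refine (decay_le_singKer hp0 (smul_ne_zero hT0.ne' hy0)).trans ?_
          rw [singKer_smul hT0]
          exact mul_le_mul_of_nonneg_left (singKer_le_decay hp0 hy1) (by positivity)
        rw [norm_mul, Real.norm_eq_abs, Real.norm_eq_abs]
        refine (mul_le_mul_of_nonneg_right h2 (abs_nonneg _)).trans_eq (by ring)
      · simp only [mul_zero, norm_zero]; positivity
    rw [integral_const_mul] at h1
    rw [norm_mul, norm_pow, Real.norm_of_nonneg hT0.le]
    refine (mul_le_mul_of_nonneg_left h1 (by positivity)).trans_eq ?_
    rw [neg_sub, sub_eq_add_neg, Real.rpow_add hT0, Real.rpow_natCast]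
    ring
  have := hnear.add hfar
  rw [add_zero] at this
  refine this.congr' ?_
  filter_upwards [eventually_ge_atTop 1] with T hT
  rw [← mul_add, ← integral_add (hInt T hT).1 (hInt T hT).2]
  simp_rw [hvw, mul_add]

lemma integrableOn_scaledInt {E : Type*} [NormedAddCommGroup E] [NormedSpace ℝ E]
    {Φ : Euc n → E} (hΦ : Continuous Φ) (hΦi : Integrable Φ) {h : Euc n → ℝ} (hm : Measurable h)
    {H : ℝ} (hh : ∀ z, |h z| ≤ H) (x : Euc n) {q : ℝ} (hq : q - n < -1) :
    IntegrableOn (fun τ : ℝ => τ ^ q • scaledInt Φ h x τ) (Ioi 1) := by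
  have hi := ((integrableOn_Ioi_rpow_of_lt hq one_pos).const_mul (H * ∫ y, ‖Φ y‖))
  refine hi.mono' ?_ ((ae_restrict_iff' measurableSet_Ioi).2 (Eventually.of_forall fun τ hτ => ?_))
  · exact ((measurable_id.pow_const q).stronglyMeasurable.smul
      (stronglyMeasurable_scaledInt hΦ hm x)).aestronglyMeasurable
  · have hτ0 : 0 < τ := zero_lt_one.trans hτ
    rw [norm_smul, Real.norm_of_nonneg (by positivity)]
    refine (mul_le_mul_of_nonneg_left (norm_scaledInt_le hΦi hh x hτ0) (by positivity)).trans_eq ?_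
    rw [Real.rpow_sub hτ0, Real.rpow_natCast]
    field_simp

lemma integrable_profile : Integrable (profile : Euc n → ℝ) :=
  contDiff_profile.continuous.integrable_of_hasCompactSupport hasCompactSupport_profile

/-- Reproducing formula: a tame function is recovered from an integral against an integrable
kernel and from the rescaled averages of its image under the operator. -/
theorem Tame.representation (hn : 1 ≤ n) (hp : n < p) (hp2 : p < n + 2) (hu : Tame p u)
    (x : Euc n) :
    (∫ y : Euc n, avgKer p y) * u x = (∫ y, avgKer p y * u (x + y)) +
      ∫ τ in Ioi (1 : ℝ), τ ^ (2 * (n : ℝ) - 1 - p) * scaledInt profile (symLap p u) x τ := by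
  obtain ⟨H, hH0, hH⟩ := hu.exists_abs_symLap_le hn hp hp2 (‖x‖ + 1)
  have hm : Measurable (symLap p u) := (stronglyMeasurable_symLap hu.continuous).measurable
  classical
  set h : Euc n → ℝ := (ball x (1 / 4)).indicator (symLap p u) with hh
  have hcongr : ∀ τ ∈ Ioi (1 : ℝ), scaledInt profile (symLap p u) x τ =
      scaledInt profile h x τ := fun τ hτ =>
    scaledInt_congr (le_of_lt hτ) (fun y => profile_eq_zero) fun z hz => by
      rw [hh, indicator_of_mem hz]
  have hInt : IntegrableOn (fun τ : ℝ => τ ^ (2 * (n : ℝ) - 1 - p) *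
      scaledInt profile (symLap p u) x τ) (Ioi 1) := by
    refine (integrableOn_scaledInt (h := h) (q := 2 * (n : ℝ) - 1 - p)
      contDiff_profile.continuous integrable_profile
      (hm.indicator measurableSet_ball) (H := H) (fun z => ?_) x (by linarith)).congr_fun
        (fun τ hτ => ?_) measurableSet_Ioi
    · simp only [hh, indicator_apply]
      split_ifs with hz
      · refine hH z ?_
        rw [mem_ball, dist_eq_norm] at hz
        linarith [norm_sub_norm_le z x]
      · simpa using hH0
    · simp only [smul_eq_mul, hcongr τ hτ]
  have h1 := intervalIntegral_tendsto_integral_Ioi 1 hInt tendsto_id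
  have h2 := (hu.tendsto_integral_avgKer hn hp hp2 x).sub_const (∫ y, avgKer p y * u (x + y))
  have h3 := tendsto_nhds_unique (h1.congr' ?_) h2
  · linarith
  · filter_upwards [eventually_ge_atTop 1] with T hT
    rw [hu.integral_avgKer_sub hn hp hp2 x hT]
    refine intervalIntegral.integral_congr fun τ hτ => ?_
    rw [id, uIcc_of_le hT] at hτ
    have hτ0 : 0 < τ := by linarith [hτ.1]
    rw [hu.integral_psi_smul hn hp hp2 x hτ0, ← mul_assoc, ← Real.rpow_natCast τ (n - 1),
      ← Real.rpow_add hτ0, Nat.cast_sub hn, Nat.cast_one]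
    ring_nf

end Representation

section Constant

variable {n : ℕ} {p : ℝ}

lemma tendsto_integral_mul_wave {k : Euc n → ℝ} (hk : Integrable k) {e : Euc n} (he : ‖e‖ = 1) :
    Tendsto (fun R : ℝ => ∫ y, k y * wave (R • e) y) atTop (𝓝 0) := by
  have h := tendsto_integral_exp_inner_smul_cocompact (fun y : Euc n => (k y : ℂ))
  have hw : Tendsto (fun R : ℝ => (R / (2 * Real.pi)) • e) atTop (cocompact (Euc n)) := by
    rw [← Metric.cobounded_eq_cocompact, ← tendsto_norm_atTop_iff_cobounded]
    simp_rw [norm_smul, he, mul_one]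
    exact tendsto_norm_atTop_atTop.comp (tendsto_id.atTop_div_const Real.two_pi_pos)
  have h2 := (Complex.continuous_re.tendsto 0).comp (h.comp hw)
  rw [Complex.zero_re] at h2
  refine h2.congr fun R => ?_
  have hi : Integrable fun v : Euc n =>
      Real.fourierChar (-⟪v, (R / (2 * Real.pi)) • e⟫) • (k v : ℂ) := by
    have hk' : Integrable fun v => (k v : ℂ) := hk.ofReal
    refine hk.norm.mono' ?_ (Eventually.of_forall fun v => by simp)
    have hc : Continuous fun v : Euc n =>
        Real.fourierChar (-⟪v, (R / (2 * Real.pi)) • e⟫) :=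
      Real.continuous_fourierChar.comp (by fun_prop)
    exact hc.aestronglyMeasurable.smul hk'.aestronglyMeasurable
  have h3 := Complex.reCLM.integral_comp_comm hi
  simp only [Function.comp_apply]
  refine h3.symm.trans (integral_congr_ae (Eventually.of_forall fun v => ?_))
  have h4 : (2 * Real.pi * -⟪v, (R / (2 * Real.pi)) • e⟫ : ℝ) = -⟪R • e, v⟫ := by
    rw [inner_smul_right, inner_smul_left, real_inner_comm]
    simp only [conj_trivial]
    field_simp
  simp only [Complex.reCLM_apply, Circle.smul_def, smul_eq_mul, Complex.re_mul_ofReal]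
  rw [Real.fourierChar_apply, h4, Complex.exp_ofReal_mul_I_re, Real.cos_neg, mul_comm, wave]

lemma scaledInt_wave (c : ℝ) (ξ : Euc n) {τ : ℝ} (hτ : 0 < τ) :
    scaledInt profile (fun z => c * wave ξ z) 0 τ =
      c * (τ ^ n)⁻¹ * ∫ y : Euc n, profile y * Real.cos ⟪τ⁻¹ • ξ, y⟫ := by
  have h := integral_comp_smul_sub hτ (fun y : Euc n => profile y * Real.cos ⟪τ⁻¹ • ξ, y⟫) 0
  rw [smul_eq_mul] at h
  rw [mul_assoc, ← h, ← integral_const_mul]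
  refine integral_congr_ae (Eventually.of_forall fun z => ?_)
  have : (⟪τ⁻¹ • ξ, τ • (z - 0)⟫ : ℝ) = ⟪ξ, z⟫ := by
    rw [inner_smul_left, inner_smul_right, sub_zero]
    simp [hτ.ne']
  simp only [smul_eq_mul, this, wave]
  ring

theorem integral_avgKer_pos (hn : 1 ≤ n) (hp : n < p) (hp2 : p < n + 2) :
    0 < ∫ y : Euc n, avgKer p y := by
  have : Nontrivial (Euc n) := by
    have : Nonempty (Fin n) := ⟨⟨0, hn⟩⟩
    infer_instance
  obtain ⟨e, he⟩ : ∃ e : Euc n, ‖e‖ = 1 := exists_norm_eq _ zero_le_one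
  obtain ⟨c, hc, hcb⟩ := exists_le_integral_profile_mul_cos n
  have hl : 0 < waveSymbol p e := waveSymbol_pos hn hp hp2 (norm_ne_zero_iff.1 (by simp [he]))
  have hpn : 0 < p - n := by linarith
  have key : ∀ R : ℝ, 1 ≤ R → waveSymbol p e * c / (p - n) +
      ∫ y, avgKer p y * wave (R • e) y ≤ ∫ y : Euc n, avgKer p y := by
    intro R hR
    have hR0 : 0 < R := by linarith
    have hrep := (tame_wave hp (R • e)).representation hn hp hp2 0
    have hs : symLap p (wave (R • e)) = fun z => waveSymbol p (R • e) * wave (R • e) z :=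
      funext fun z => symLap_wave _ _
    set l := waveSymbol p (R • e) with hldef
    have hl0 : l = R ^ (p - n) * waveSymbol p e := waveSymbol_smul hR0 e
    have hlpos : 0 < l := by rw [hl0]; positivity
    rw [hs] at hrep
    simp only [zero_add] at hrep
    have hw0 : wave (R • e) 0 = 1 := by simp [wave]
    rw [hw0, mul_one] at hrep
    have hInt : IntegrableOn (fun τ : ℝ => τ ^ (2 * (n : ℝ) - 1 - p) *
        scaledInt profile (fun z => l * wave (R • e) z) 0 τ) (Ioi 1) := by
      refine integrableOn_scaledInt contDiff_profile.continuous integrable_profile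
        ((continuous_wave _).measurable.const_mul l) (H := l) (fun z => ?_) 0 (by linarith)
      rw [abs_mul, abs_of_pos hlpos]
      exact mul_le_of_le_one_right hlpos.le (Real.abs_cos_le_one _)
    have hval : ∀ τ ∈ Ioi (1 : ℝ), τ ^ (2 * (n : ℝ) - 1 - p) *
        scaledInt profile (fun z => l * wave (R • e) z) 0 τ =
        l * τ ^ ((n : ℝ) - 1 - p) *
          ∫ y : Euc n, profile y * Real.cos ⟪τ⁻¹ • R • e, y⟫ := by
      intro τ hτ
      have hτ0 : 0 < τ := zero_lt_one.trans hτ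
      have h1 : τ ^ (2 * (n : ℝ) - 1 - p) = τ ^ ((n : ℝ) - 1 - p) * τ ^ n := by
        rw [← Real.rpow_natCast τ n, ← Real.rpow_add hτ0]; ring_nf
      rw [scaledInt_wave _ _ hτ0, h1]
      field_simp
    have hbase : IntegrableOn (fun τ : ℝ => τ ^ ((n : ℝ) - 1 - p)) (Ioi R) :=
      integrableOn_Ioi_rpow_of_lt (by linarith) hR0
    have h2 : ∫ τ in Ioi R, l * τ ^ ((n : ℝ) - 1 - p) * c = waveSymbol p e * c / (p - n) := by
      rw [integral_mul_const, integral_const_mul, integral_Ioi_rpow_of_lt (by linarith) hR0, hl0]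
      have h6 : (n : ℝ) - 1 - p + 1 = -(p - n) := by ring
      have h7 : R ^ (p - n) * R ^ (-(p - n)) = 1 := by
        rw [← Real.rpow_add hR0, add_neg_cancel, Real.rpow_zero]
      rw [h6, div_neg, neg_div, neg_neg]
      linear_combination (waveSymbol p e * c / (p - n)) * h7
    have h3 : ∫ τ in Ioi R, l * τ ^ ((n : ℝ) - 1 - p) * c ≤
        ∫ τ in Ioi (1 : ℝ), τ ^ (2 * (n : ℝ) - 1 - p) *
          scaledInt profile (fun z => l * wave (R • e) z) 0 τ := by
      refine (setIntegral_mono_on ((hbase.const_mul l).mul_const c)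
        (hInt.mono_set (Ioi_subset_Ioi hR)) measurableSet_Ioi fun τ hτ => ?_).trans
        (setIntegral_mono_set hInt ((ae_restrict_iff' measurableSet_Ioi).2
          (Eventually.of_forall fun τ hτ => ?_)) (Ioi_subset_Ioi hR).eventuallyLE)
      · have hτ0 : 0 < τ := hR0.trans hτ
        rw [hval τ (hR.trans_lt hτ)]
        refine mul_le_mul_of_nonneg_left (hcb _ ?_) (by positivity)
        rw [norm_smul, norm_smul, he, mul_one, Real.norm_of_nonneg (by positivity),
          Real.norm_of_nonneg hR0.le, inv_mul_le_iff₀ hτ0, mul_one]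
        exact le_of_lt hτ
      · have hτ0 : 0 < τ := zero_lt_one.trans hτ
        refine le_of_le_of_eq ?_ (hval τ hτ).symm
        exact mul_nonneg (by positivity) (integral_profile_mul_cos_nonneg _)
    rw [hrep]
    linarith
  have hlim := (tendsto_integral_mul_wave (integrable_avgKer hn hp hp2) he).const_add
    (waveSymbol p e * c / (p - n))
  rw [add_zero] at hlim
  have := le_of_tendsto hlim ((eventually_ge_atTop 1).mono key)
  exact (by positivity : 0 < waveSymbol p e * c / (p - n)).trans_le this

end Constant

section SmoothPart

variable {n : ℕ} {p : ℝ}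

/-- The part of the reproducing formula given by the averaged kernel. -/
def avgPart {n : ℕ} (p : ℝ) (u : Euc n → ℝ) (x : Euc n) : ℝ := ∫ y, avgKer p y * u (x + y)

/-- The gradient of `avgPart`. -/
def davgPart {n : ℕ} (p : ℝ) (u : Euc n → ℝ) (x : Euc n) : Euc n →L[ℝ] ℝ :=
  -∫ z, u z • davgKer p (z - x)

lemma avgPart_eq (u : Euc n → ℝ) (x : Euc n) :
    avgPart p u x = ∫ z, avgKer p (z - x) * u z := by
  have h := integral_add_left_eq_self (μ := volume) (fun z => avgKer p (z - x) * u z) x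
  simp only [add_sub_cancel_left] at h
  exact h

lemma decay_sub_le (hp : 0 < p) {x z : Euc n} (hx : x ∈ ball (0 : Euc n) 1) :
    decay p (z - x) ≤ 2 ^ p * decay p z := by
  have h := decay_le_of_norm_le hp (x := z - x) (mem_ball_zero_iff.1 hx).le
  norm_num at h
  exact h

lemma continuous_davgKer (hn : 1 ≤ n) (hp : n < p) (hp2 : p < n + 2) :
    Continuous (davgKer p : Euc n → Euc n →L[ℝ] ℝ) := by
  obtain ⟨L, hL0, hL⟩ := exists_norm_davgKer_sub_le hn hp hp2
  refine continuous_iff_continuousAt.2 fun x => ?_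
  rw [ContinuousAt, tendsto_iff_norm_sub_tendsto_zero]
  have h1 : Tendsto (fun y : Euc n => L * decay p x * ‖x - y‖) (𝓝 x) (𝓝 0) := by
    have : Continuous fun y : Euc n => L * decay p x * ‖x - y‖ := by fun_prop
    simpa using this.tendsto x
  refine squeeze_zero' (Eventually.of_forall fun _ => norm_nonneg _) ?_ h1
  filter_upwards [closedBall_mem_nhds x one_pos] with y hy
  rw [norm_sub_rev]
  exact hL x y (by rwa [mem_closedBall, dist_eq_norm, norm_sub_rev] at hy)

lemma Tame.integrable_smul_davgKer (hn : 1 ≤ n) (hp : n < p) (hp2 : p < n + 2)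
    {u : Euc n → ℝ} (hu : Tame p u) {x : Euc n} (hx : x ∈ ball (0 : Euc n) 1) :
    Integrable fun z => u z • davgKer p (z - x) := by
  have hp0 : 0 < p := (Nat.cast_nonneg n).trans_lt hp
  obtain ⟨B, hB0, hB⟩ := exists_norm_davgKer_le hn hp hp2
  have hc := continuous_davgKer hn hp hp2
  have huc := hu.continuous
  refine (hu.integrable_abs.const_mul (B * 2 ^ p)).mono'
    (by fun_prop : Continuous fun z => u z • davgKer p (z - x)).aestronglyMeasurable
    (Eventually.of_forall fun z => ?_)
  rw [norm_smul, Real.norm_eq_abs]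
  have h1 := (hB (z - x)).trans (mul_le_mul_of_nonneg_left (decay_sub_le hp0 hx) hB0)
  refine (mul_le_mul_of_nonneg_left h1 (abs_nonneg _)).trans_eq (by ring)

lemma exists_avgPart_bounds (hn : 1 ≤ n) (hp : n < p) (hp2 : p < n + 2) :
    ∃ C, 0 ≤ C ∧ ∀ u : Euc n → ℝ, Tame p u →
      (∀ x ∈ ball (0 : Euc n) 1, HasFDerivAt (avgPart p u) (davgPart p u x) x ∧
        |avgPart p u x| ≤ C * (∫ z, decay p z * |u z|) ∧
        ‖davgPart p u x‖ ≤ C * (∫ z, decay p z * |u z|)) ∧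
      ∀ x ∈ ball (0 : Euc n) 1, ∀ x' ∈ ball (0 : Euc n) 1, ‖x - x'‖ ≤ 1 →
        ‖davgPart p u x - davgPart p u x'‖ ≤ C * (∫ z, decay p z * |u z|) * ‖x - x'‖ := by
  have hp0 : 0 < p := (Nat.cast_nonneg n).trans_lt hp
  obtain ⟨A, hA0, hA⟩ := exists_abs_avgKer_le hn hp hp2
  obtain ⟨B, hB0, hB⟩ := exists_norm_davgKer_le hn hp hp2
  obtain ⟨L, hL0, hL⟩ := exists_norm_davgKer_sub_le hn hp hp2
  have hKc := continuous_avgKer hn hp hp2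
  refine ⟨(A + B + L) * 2 ^ p, by positivity, fun u hu => ?_⟩
  have hN := hu.integrable_abs
  have huc := hu.continuous
  have hN0 : 0 ≤ ∫ z, decay p z * |u z| :=
    integral_nonneg fun z => mul_nonneg (decay_pos z).le (abs_nonneg _)
  have hdK := continuous_davgKer hn hp hp2
  have hAb : ∀ x ∈ ball (0 : Euc n) 1, ∀ z,
      ‖avgKer p (z - x) * u z‖ ≤ A * 2 ^ p * (decay p z * |u z|) := by
    intro x hx z
    rw [norm_mul, Real.norm_eq_abs, Real.norm_eq_abs]
    have h1 := (hA (z - x)).trans (mul_le_mul_of_nonneg_left (decay_sub_le hp0 hx) hA0)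
    refine (mul_le_mul_of_nonneg_right h1 (abs_nonneg _)).trans_eq (by ring)
  have hBb : ∀ x ∈ ball (0 : Euc n) 1, ∀ z,
      ‖-(u z • davgKer p (z - x))‖ ≤ B * 2 ^ p * (decay p z * |u z|) := by
    intro x hx z
    rw [norm_neg, norm_smul, Real.norm_eq_abs]
    have h1 := (hB (z - x)).trans (mul_le_mul_of_nonneg_left (decay_sub_le hp0 hx) hB0)
    refine (mul_le_mul_of_nonneg_left h1 (abs_nonneg _)).trans_eq (by ring)
  have hp2' : (0 : ℝ) ≤ 2 ^ p := by positivity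
  have hmono : ∀ c, 0 ≤ c → c ≤ A + B + L →
      c * 2 ^ p * (∫ z, decay p z * |u z|) ≤ (A + B + L) * 2 ^ p * ∫ z, decay p z * |u z| :=
    fun c _ h => mul_le_mul_of_nonneg_right (mul_le_mul_of_nonneg_right h hp2') hN0
  refine ⟨fun x hx => ⟨?_, ?_, ?_⟩, fun x hx x' hx' hxx => ?_⟩
  · have hcA : ∀ y : Euc n, Continuous fun z => avgKer p (z - y) * u z := fun y => by fun_prop
    have h := hasFDerivAt_integral_of_dominated_of_fderiv_le (𝕜 := ℝ)
      (F := fun x z => avgKer p (z - x) * u z) (F' := fun x z => -(u z • davgKer p (z - x)))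
      (bound := fun z => B * 2 ^ p * (decay p z * |u z|)) (μ := volume)
      (isOpen_ball.mem_nhds hx)
      (Eventually.of_forall fun y => (hcA y).aestronglyMeasurable)
      ((hN.const_mul (A * 2 ^ p)).mono' (hcA x).aestronglyMeasurable
        (Eventually.of_forall (hAb x hx)))
      (by fun_prop : Continuous fun z => -(u z • davgKer p (z - x))).aestronglyMeasurable
      (Eventually.of_forall fun z y hy => hBb y hy z) (hN.const_mul _)
      (Eventually.of_forall fun z y _ => ?_)
    · have e : avgPart p u = fun x => ∫ z, avgKer p (z - x) * u z := funext (avgPart_eq u)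
      rw [e, davgPart, ← integral_neg]
      exact h
    · have h1 : HasFDerivAt (fun y : Euc n => z - y) (-ContinuousLinearMap.id ℝ (Euc n)) y :=
        (hasFDerivAt_id y).const_sub z
      have h2 := ((hasFDerivAt_avgKer hn hp hp2 (z - y)).comp y h1).mul_const (u z)
      refine h2.congr_fderiv (ContinuousLinearMap.ext fun v => ?_)
      simp
  · rw [avgPart_eq]
    refine (norm_integral_le_of_norm_le (hN.const_mul (A * 2 ^ p))
      (Eventually.of_forall (hAb x hx))).trans ?_
    rw [integral_const_mul]
    exact hmono A hA0 (by linarith)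
  · rw [davgPart, ← integral_neg]
    refine (norm_integral_le_of_norm_le (hN.const_mul (B * 2 ^ p))
      (Eventually.of_forall (hBb x hx))).trans ?_
    rw [integral_const_mul]
    exact hmono B hB0 (by linarith)
  · have e : davgPart p u x - davgPart p u x' =
        ∫ z, u z • (davgKer p (z - x') - davgKer p (z - x)) := by
      simp_rw [smul_sub]
      rw [integral_sub (hu.integrable_smul_davgKer hn hp hp2 hx')
        (hu.integrable_smul_davgKer hn hp hp2 hx), davgPart, davgPart]
      abel
    rw [e]
    refine (norm_integral_le_of_norm_le (hN.const_mul (L * 2 ^ p * ‖x - x'‖))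
      (Eventually.of_forall fun z => ?_)).trans ?_
    · rw [norm_smul, Real.norm_eq_abs]
      have h0 : z - x' - (z - x) = x - x' := by abel
      have h1 := hL (z - x') (z - x) (by rwa [h0])
      rw [h0] at h1
      have h2 := h1.trans (mul_le_mul_of_nonneg_right
        (mul_le_mul_of_nonneg_left (decay_sub_le hp0 hx') hL0) (norm_nonneg _))
      refine (mul_le_mul_of_nonneg_left h2 (abs_nonneg _)).trans_eq (by ring)
    · rw [integral_const_mul, mul_right_comm]
      exact mul_le_mul_of_nonneg_right (hmono L hL0 (by linarith)) (norm_nonneg _)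

end SmoothPart

section RoughPart

variable {n : ℕ} {E : Type*} [NormedAddCommGroup E] [NormedSpace ℝ E]

lemma exists_integral_norm_sub_le {f : Euc n → E} (hf : ContDiff ℝ 1 f)
    (hs : ∀ y, 1 / 4 ≤ ‖y‖ → f y = 0) :
    ∃ C, 0 ≤ C ∧ ∀ β : ℝ, 0 ≤ β → β ≤ 1 → ∀ v : Euc n,
      ∫ y, ‖f y - f (y - v)‖ ≤ C * ‖v‖ ^ β := by
  have hc : HasCompactSupport f := HasCompactSupport.intro (isCompact_closedBall 0 (1 / 4))
    fun x hx => hs x (by rw [mem_closedBall_zero_iff, not_le] at hx; exact hx.le)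
  obtain ⟨L, hL⟩ := hf.lipschitzWith_of_hasCompactSupport hc one_ne_zero
  have hi : Integrable f := hf.continuous.integrable_of_hasCompactSupport hc
  set V := (volume : Measure (Euc n)).real (closedBall 0 2) with hV
  have hI : 0 ≤ ∫ y, ‖f y‖ := integral_nonneg fun _ => norm_nonneg _
  refine ⟨L * V + 2 * ∫ y, ‖f y‖, by positivity, fun β h0 h1 v => ?_⟩
  have hLV : 0 ≤ L * V := by positivity
  rcases le_total ‖v‖ 1 with hv | hv
  · have hle : ‖v‖ ≤ ‖v‖ ^ β := by
      rcases (norm_nonneg v).eq_or_lt with h | h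
      · rw [← h]; positivity
      · simpa using Real.rpow_le_rpow_of_exponent_ge h hv h1
    have hb : ∫ y, ‖f y - f (y - v)‖ ≤ L * ‖v‖ * V := by
      have hz : ∀ y, y ∉ closedBall (0 : Euc n) 2 → ‖f y - f (y - v)‖ = 0 := by
        intro y hy
        rw [mem_closedBall_zero_iff, not_le] at hy
        rw [hs y (by linarith), hs (y - v) (by linarith [norm_sub_norm_le y v]), sub_zero,
          norm_zero]
      rw [← setIntegral_eq_integral_of_forall_compl_eq_zero hz]
      refine (Real.le_norm_self _).trans (norm_setIntegral_le_of_norm_le_const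
        measure_closedBall_lt_top fun y _ => ?_)
      rw [norm_norm]
      simpa using hL.norm_sub_le y (y - v)
    refine hb.trans ?_
    have : L * V * ‖v‖ ≤ (L * V + 2 * ∫ y, ‖f y‖) * ‖v‖ ^ β := by gcongr; linarith
    linarith
  · have hge : 1 ≤ ‖v‖ ^ β := Real.one_le_rpow hv h0
    have hb : ∫ y, ‖f y - f (y - v)‖ ≤ 2 * ∫ y, ‖f y‖ := by
      calc _ ≤ ∫ y, (‖f y‖ + ‖f (y - v)‖) :=
            integral_mono (hi.sub (hi.comp_sub_right v)).norm
              (hi.norm.add (hi.comp_sub_right v).norm) fun y => norm_sub_le _ _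
        _ = _ := by
            rw [integral_add hi.norm (hi.comp_sub_right v).norm,
              integral_sub_right_eq_self (fun y => ‖f y‖) v]
            ring
    refine hb.trans ?_
    nlinarith

variable {Φ : Euc n → E} {h : Euc n → ℝ} {H : ℝ}

lemma integrable_smul_scaled (hΦ : Continuous Φ) (hΦi : Integrable Φ) (hm : Measurable h)
    (hh : ∀ z, |h z| ≤ H) (x : Euc n) {τ : ℝ} (hτ : 0 < τ) :
    Integrable fun z => h z • Φ (τ • (z - x)) := by
  refine ((Integrable.comp_smul_sub hτ hΦi x).norm.const_mul H).mono' ?_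
    (Eventually.of_forall fun z => ?_)
  · exact (hm.stronglyMeasurable.smul
      (hΦ.comp (by fun_prop)).stronglyMeasurable).aestronglyMeasurable
  · rw [norm_smul]
    exact mul_le_mul_of_nonneg_right (hh z) (norm_nonneg _)

lemma norm_scaledInt_sub_le (hΦ : Continuous Φ) (hΦi : Integrable Φ) (hm : Measurable h)
    (hh : ∀ z, |h z| ≤ H) (hH : 0 ≤ H) {C β : ℝ}
    (hC : ∀ v : Euc n, ∫ y, ‖Φ y - Φ (y - v)‖ ≤ C * ‖v‖ ^ β)
    (x x' : Euc n) {τ : ℝ} (hτ : 0 < τ) :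
    ‖scaledInt Φ h x τ - scaledInt Φ h x' τ‖ ≤
      H * C * (τ ^ n)⁻¹ * τ ^ β * ‖x - x'‖ ^ β := by
  unfold scaledInt
  rw [← integral_sub (integrable_smul_scaled hΦ hΦi hm hh x hτ)
    (integrable_smul_scaled hΦ hΦi hm hh x' hτ)]
  have hi : Integrable fun z => ‖Φ (τ • (z - x)) - Φ (τ • (z - x) - τ • (x' - x))‖ :=
    Integrable.comp_smul_sub hτ
      (f := fun y => ‖Φ y - Φ (y - τ • (x' - x))‖) (hΦi.sub (hΦi.comp_sub_right _)).norm x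
  refine (norm_integral_le_of_norm_le (hi.const_mul H) (Eventually.of_forall fun z => ?_)).trans ?_
  · have e : τ • (z - x) - τ • (x' - x) = τ • (z - x') := by rw [← smul_sub]; congr 1; abel
    rw [e, ← smul_sub, norm_smul]
    exact mul_le_mul_of_nonneg_right (hh z) (norm_nonneg _)
  · rw [integral_const_mul,
      integral_comp_smul_sub hτ (fun y => ‖Φ y - Φ (y - τ • (x' - x))‖) x, smul_eq_mul]
    have h1 := hC (τ • (x' - x))
    rw [norm_smul, Real.norm_of_nonneg hτ.le, Real.mul_rpow hτ.le (norm_nonneg _),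
      norm_sub_rev] at h1
    calc _ ≤ H * ((τ ^ n)⁻¹ * (C * (τ ^ β * ‖x - x'‖ ^ β))) := by gcongr
      _ = _ := by ring

/-- The superposition of the rescaled averages over all scales. -/
def scalePart (q : ℝ) (Φ : Euc n → E) (h : Euc n → ℝ) (x : Euc n) : E :=
  ∫ τ in Ioi (1 : ℝ), τ ^ q • scaledInt Φ h x τ

lemma exists_scalePart_bounds (hΦ : ContDiff ℝ 1 Φ) (hs : ∀ y, 1 / 4 ≤ ‖y‖ → Φ y = 0)
    {q β : ℝ} (hβ0 : 0 ≤ β) (hβ1 : β ≤ 1) (hq : q - n + β < -1) :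
    ∃ C, 0 ≤ C ∧ ∀ (h : Euc n → ℝ) (H : ℝ), Measurable h → 0 ≤ H → (∀ z, |h z| ≤ H) →
      (∀ x, ‖scalePart q Φ h x‖ ≤ C * H) ∧
      ∀ x x', ‖scalePart q Φ h x - scalePart q Φ h x'‖ ≤ C * H * ‖x - x'‖ ^ β := by
  have hc : HasCompactSupport Φ := HasCompactSupport.intro (isCompact_closedBall 0 (1 / 4))
    fun x hx => hs x (by rw [mem_closedBall_zero_iff, not_le] at hx; exact hx.le)
  have hΦi : Integrable Φ := hΦ.continuous.integrable_of_hasCompactSupport hc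
  obtain ⟨C, hC0, hC⟩ := exists_integral_norm_sub_le hΦ hs
  have hI0 : 0 ≤ ∫ y, ‖Φ y‖ := integral_nonneg fun _ => norm_nonneg _
  set J₁ := ∫ τ in Ioi (1 : ℝ), τ ^ (q - n) with hJ₁
  set J₂ := ∫ τ in Ioi (1 : ℝ), τ ^ (q - n + β) with hJ₂
  have hnn : ∀ r : ℝ, 0 ≤ ∫ τ in Ioi (1 : ℝ), τ ^ r := fun r =>
    setIntegral_nonneg measurableSet_Ioi fun τ hτ =>
      Real.rpow_nonneg (zero_le_one.trans (le_of_lt hτ)) _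
  have hJ₁0 : 0 ≤ J₁ := hnn _
  have hJ₂0 : 0 ≤ J₂ := hnn _
  have hInt₁ : IntegrableOn (fun τ : ℝ => τ ^ (q - n)) (Ioi 1) :=
    integrableOn_Ioi_rpow_of_lt (by linarith) one_pos
  have hInt₂ : IntegrableOn (fun τ : ℝ => τ ^ (q - n + β)) (Ioi 1) :=
    integrableOn_Ioi_rpow_of_lt hq one_pos
  have hpow : ∀ τ : ℝ, 0 < τ → τ ^ q * (τ ^ n)⁻¹ = τ ^ (q - n) := fun τ hτ => by
    rw [Real.rpow_sub hτ, Real.rpow_natCast, div_eq_mul_inv]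
  refine ⟨(∫ y, ‖Φ y‖) * J₁ + C * J₂, by positivity, fun h H hm hH hh => ⟨fun x => ?_,
    fun x x' => ?_⟩⟩
  · have h1 : ‖scalePart q Φ h x‖ ≤ ∫ τ in Ioi (1 : ℝ), (H * ∫ y, ‖Φ y‖) * τ ^ (q - n) := by
      refine norm_integral_le_of_norm_le (hInt₁.const_mul _)
        ((ae_restrict_iff' measurableSet_Ioi).2 (Eventually.of_forall fun τ hτ => ?_))
      have hτ0 : 0 < τ := zero_lt_one.trans hτ
      rw [norm_smul, Real.norm_of_nonneg (by positivity), ← hpow τ hτ0]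
      refine (mul_le_mul_of_nonneg_left (norm_scaledInt_le hΦi hh x hτ0)
        (by positivity)).trans_eq (by ring)
    rw [integral_const_mul] at h1
    have : 0 ≤ C * J₂ * H := by positivity
    linarith
  · have h1 : ‖scalePart q Φ h x - scalePart q Φ h x'‖ ≤
        ∫ τ in Ioi (1 : ℝ), (H * C * ‖x - x'‖ ^ β) * τ ^ (q - n + β) := by
      unfold scalePart
      rw [← integral_sub
        (integrableOn_scaledInt hΦ.continuous hΦi hm hh x (by linarith))
        (integrableOn_scaledInt hΦ.continuous hΦi hm hh x' (by linarith))]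
      refine norm_integral_le_of_norm_le (hInt₂.const_mul _)
        ((ae_restrict_iff' measurableSet_Ioi).2 (Eventually.of_forall fun τ hτ => ?_))
      have hτ0 : 0 < τ := zero_lt_one.trans hτ
      rw [← smul_sub, norm_smul, Real.norm_of_nonneg (by positivity), Real.rpow_add hτ0,
        ← hpow τ hτ0]
      refine (mul_le_mul_of_nonneg_left (norm_scaledInt_sub_le hΦ.continuous hΦi hm hh hH
        (hC β hβ0 hβ1) x x' hτ0) (by positivity)).trans_eq (by ring)
    rw [integral_const_mul] at h1
    have : 0 ≤ (∫ y, ‖Φ y‖) * J₁ * H * ‖x - x'‖ ^ β := by positivity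
    linarith

lemma hasFDerivAt_scaledInt (hm : Measurable h) (hi : Integrable h) (x : Euc n) (τ : ℝ) :
    HasFDerivAt (fun x => scaledInt profile h x τ)
      (-(τ • scaledInt (fderiv ℝ profile) h x τ)) x := by
  have hdc : Continuous (fderiv ℝ (profile : Euc n → ℝ)) := contDiff_fderiv_profile.continuous
  have hpc : Continuous (profile : Euc n → ℝ) := contDiff_profile.continuous
  obtain ⟨M, hM⟩ := hasCompactSupport_profile.exists_bound_of_continuous hpc
    (f := (profile : Euc n → ℝ))
  obtain ⟨D, hD⟩ := (hasCompactSupport_profile.fderiv ℝ).exists_bound_of_continuous hdc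
  have hFm : ∀ y : Euc n, AEStronglyMeasurable (fun z => h z • profile (τ • (z - y))) volume :=
    fun y => (hm.stronglyMeasurable.smul
      (hpc.comp (by fun_prop : Continuous fun z : Euc n => τ • (z - y))).stronglyMeasurable
        ).aestronglyMeasurable
  have key := hasFDerivAt_integral_of_dominated_of_fderiv_le (𝕜 := ℝ) (μ := volume)
    (F := fun x z => h z • profile (τ • (z - x)))
    (F' := fun x z => h z • -(τ • fderiv ℝ profile (τ • (z - x))))
    (bound := fun z => |h z| * (|τ| * D)) (x₀ := x) univ_mem
    (Eventually.of_forall hFm)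
    ((hi.abs.mul_const M).mono' (hFm x) (Eventually.of_forall fun z => ?_))
    (hm.stronglyMeasurable.smul (by fun_prop : Continuous fun z : Euc n =>
      -(τ • fderiv ℝ profile (τ • (z - x)))).stronglyMeasurable).aestronglyMeasurable
    (Eventually.of_forall fun z y _ => ?_) (hi.abs.mul_const _)
    (Eventually.of_forall fun z y _ => ?_)
  · refine key.congr_fderiv ?_
    unfold scaledInt
    rw [← integral_smul, ← integral_neg]
    refine integral_congr_ae (Eventually.of_forall fun z => ?_)
    simp only [smul_neg, smul_comm τ]
  · rw [norm_smul]
    exact mul_le_mul_of_nonneg_left (hM _) (norm_nonneg _)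
  · rw [norm_smul, norm_neg, norm_smul]
    exact mul_le_mul_of_nonneg_left (mul_le_mul_of_nonneg_left (hD _) (norm_nonneg _))
      (norm_nonneg _)
  · have h1 : HasFDerivAt (fun y : Euc n => τ • (z - y))
        (τ • -ContinuousLinearMap.id ℝ (Euc n)) y := ((hasFDerivAt_id y).const_sub z).const_smul τ
    have h2 := (((contDiff_profile.differentiable (by norm_num)) (τ • (z - y))).hasFDerivAt.comp
      y h1).const_smul (h z)
    refine h2.congr_fderiv (ContinuousLinearMap.ext fun v => ?_)
    simp

lemma hasFDerivAt_scalePart (hm : Measurable h) (hi : Integrable h) (hh : ∀ z, |h z| ≤ H)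
    {q : ℝ} (hq : q + 1 - n < -1) (x : Euc n) :
    HasFDerivAt (scalePart q profile h) (-scalePart (q + 1) (fderiv ℝ profile) h x) x := by
  have hdc : Continuous (fderiv ℝ (profile : Euc n → ℝ)) := contDiff_fderiv_profile.continuous
  have hdi : Integrable (fderiv ℝ (profile : Euc n → ℝ)) :=
    hdc.integrable_of_hasCompactSupport (hasCompactSupport_profile.fderiv ℝ)
  have hpc : Continuous (profile : Euc n → ℝ) := contDiff_profile.continuous
  have hpow : Measurable fun τ : ℝ => τ ^ q := measurable_id.pow_const q
  have key := hasFDerivAt_integral_of_dominated_of_fderiv_le (𝕜 := ℝ)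
    (μ := volume.restrict (Ioi (1 : ℝ)))
    (F := fun x τ => τ ^ q • scaledInt profile h x τ)
    (F' := fun x τ => τ ^ q • -(τ • scaledInt (fderiv ℝ profile) h x τ))
    (bound := fun τ => (H * ∫ y : Euc n, ‖fderiv ℝ profile y‖) * τ ^ (q + 1 - n))
    (x₀ := x) univ_mem
    (Eventually.of_forall fun y => (hpow.stronglyMeasurable.smul
      (stronglyMeasurable_scaledInt hpc hm y)).aestronglyMeasurable)
    (integrableOn_scaledInt hpc integrable_profile hm hh x (by linarith))
    (hpow.stronglyMeasurable.smul (stronglyMeasurable_id.smul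
      (stronglyMeasurable_scaledInt hdc hm x)).neg).aestronglyMeasurable
    ((ae_restrict_iff' measurableSet_Ioi).2 (Eventually.of_forall fun τ hτ y _ => ?_))
    ((integrableOn_Ioi_rpow_of_lt hq one_pos).const_mul _)
    (Eventually.of_forall fun τ y _ => (hasFDerivAt_scaledInt hm hi y τ).const_smul (τ ^ q))
  · refine key.congr_fderiv ?_
    unfold scalePart
    rw [← integral_neg]
    refine setIntegral_congr_fun measurableSet_Ioi fun τ hτ => ?_
    have hτ0 : 0 < τ := zero_lt_one.trans hτ
    simp only [smul_neg, smul_smul, Real.rpow_add_one hτ0.ne']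
  · have hτ0 : 0 < τ := zero_lt_one.trans hτ
    rw [norm_smul, norm_neg, norm_smul, Real.norm_of_nonneg (by positivity),
      Real.norm_of_nonneg hτ0.le, Real.rpow_sub hτ0, Real.rpow_add_one hτ0.ne',
      Real.rpow_natCast]
    calc _ ≤ τ ^ q * (τ * (H * (τ ^ n)⁻¹ * ∫ y : Euc n, ‖fderiv ℝ profile y‖)) := by
          have := norm_scaledInt_le hdi hh y hτ0
          gcongr
      _ = _ := by field_simp

end RoughPart

section TailBound

variable {n : ℕ} {p : ℝ}

lemma exists_decay_le_neg_symLap (hn : 1 ≤ n) (hp : n < p) (hp2 : p < n + 2) :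
    ∃ c, 0 < c ∧ ∀ x : Euc n, 1 / 2 ≤ ‖x‖ → c * decay p x ≤ -symLap p radialBump x := by
  have hp0 : 0 < p := (Nat.cast_nonneg n).trans_lt hp
  have hb2 : ContDiff ℝ 2 (radialBump : Euc n → ℝ) := contDiff_radialBump.of_le (by norm_num)
  obtain ⟨C, -, hC⟩ := exists_integral_norm_symLap_le hn hp hp2 hb2 hasCompactSupport_radialBump
  have hbi : Integrable (radialBump : Euc n → ℝ) :=
    hb2.continuous.integrable_of_hasCompactSupport hasCompactSupport_radialBump
  have hpos : (0 : ℝ) < (1 + 1 / 8) ^ p := by positivity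
  refine ⟨((1 + 1 / 8) ^ p)⁻¹ * ∫ x : Euc n, radialBump x,
    mul_pos (inv_pos.2 hpos) integral_radialBump_pos, fun x hx => ?_⟩
  have hle : ∀ y, ((1 + 1 / 8) ^ p)⁻¹ * decay p x * radialBump (x + y) ≤
      -(singKer p y • secondDiff radialBump x y) := by
    intro y
    have h0 : radialBump x = 0 := radialBump_eq_zero (by linarith)
    have hk := singKer_nonneg (p := p) y
    have hb1 := radialBump_nonneg (x + y)
    have hb2 := radialBump_nonneg (x - y)
    have e : -(singKer p y • secondDiff radialBump x y) =
        singKer p y * radialBump (x + y) + singKer p y * radialBump (x - y) := by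
      simp only [secondDiff, h0, smul_eq_mul]; ring
    rw [e]
    refine le_add_of_le_of_nonneg ?_ (mul_nonneg hk hb2)
    rcases le_or_gt (1 / 8) ‖x + y‖ with h | h
    · simp [radialBump_eq_zero h]
    refine mul_le_mul_of_nonneg_right ?_ hb1
    have hy : y ≠ 0 := by
      rintro rfl
      rw [add_zero] at h
      linarith
    rw [inv_mul_le_iff₀ hpos, ← decay_neg]
    have h1 := decay_le_of_norm_le hp0 (x := -x) h.le
    rw [neg_add_cancel_left] at h1
    exact h1.trans (mul_le_mul_of_nonneg_left (decay_le_singKer hp0 hy) hpos.le)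
  have hi : Integrable fun y => radialBump (x + y) := hbi.comp_add_left x
  have h1 := integral_mono (hi.const_mul _) (hC x).1.neg hle
  simp only [Pi.neg_apply] at h1
  rw [integral_const_mul, integral_neg, integral_add_left_eq_self radialBump x] at h1
  unfold symLap
  linarith

/-- A nonnegative function has its weighted `L¹` norm controlled by the local size of the function
and of its image under the nonlocal operator. -/
lemma exists_integral_decay_mul_le (hn : 1 ≤ n) (hp : n < p) (hp2 : p < n + 2) :
    ∃ C, 0 ≤ C ∧ ∀ (u : Euc n → ℝ) (Kh Ku : ℝ), Tame p u → (∀ x, 0 ≤ u x) →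
      (∀ x ∈ ball (0 : Euc n) 1, |symLap p u x| ≤ Kh) → (∀ x ∈ ball (0 : Euc n) 1, u x ≤ Ku) →
      ∫ z, decay p z * |u z| ≤ C * (Kh + Ku) := by
  have hb2 : ContDiff ℝ 2 (radialBump : Euc n → ℝ) := contDiff_radialBump.of_le (by norm_num)
  obtain ⟨c, hc, hcS⟩ := exists_decay_le_neg_symLap hn hp hp2
  obtain ⟨C, hC0, hC⟩ := exists_norm_symLap_le hn hp hp2 hb2 hasCompactSupport_radialBump
  have hbi : Integrable (radialBump : Euc n → ℝ) :=
    hb2.continuous.integrable_of_hasCompactSupport hasCompactSupport_radialBump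
  have hd : Integrable (decay p : Euc n → ℝ) := integrable_decay hp
  set I := ∫ x : Euc n, radialBump x with hI
  set J := ∫ x : Euc n, decay p x with hJ
  have hI0 : 0 ≤ I := integral_nonneg radialBump_nonneg
  have hJ0 : 0 ≤ J := integral_nonneg fun x => (decay_pos x).le
  refine ⟨c⁻¹ * (I + (c + C) * J), by positivity, fun u Kh Ku hu h0 hKh hKu => ?_⟩
  have hz : (0 : Euc n) ∈ ball (0 : Euc n) 1 := mem_ball_self one_pos
  have hKh0 : 0 ≤ Kh := (abs_nonneg _).trans (hKh 0 hz)
  have hKu0 : 0 ≤ Ku := (h0 0).trans (hKu 0 hz)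
  have hS : Integrable fun x => symLap p radialBump x * u x := by
    refine (hu.integrable_abs.const_mul C).mono'
      ((stronglyMeasurable_symLap hb2.continuous).mul
        hu.continuous.stronglyMeasurable).aestronglyMeasurable (Eventually.of_forall fun x => ?_)
    rw [norm_mul, ← mul_assoc]
    exact mul_le_mul_of_nonneg_right (hC x) (abs_nonneg _)
  have hle : ∀ x, c * (decay p x * |u x|) ≤
      (c + C) * Ku * decay p x - symLap p radialBump x * u x := by
    intro x
    have hdx := decay_pos (p := p) x
    have hux := h0 x
    rw [abs_of_nonneg hux]
    rcases le_or_gt (1 / 2) ‖x‖ with h | h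
    · have h1 := mul_le_mul_of_nonneg_right (hcS x h) hux
      have h2 : 0 ≤ (c + C) * Ku * decay p x := by positivity
      linarith
    · have h1 := mul_le_mul_of_nonneg_right ((le_abs_self _).trans (hC x)) hux
      have h2 : (c + C) * decay p x * u x ≤ (c + C) * decay p x * Ku :=
        mul_le_mul_of_nonneg_left (hKu x (mem_ball_zero_iff.2 (by linarith))) (by positivity)
      linarith
  have h1 := integral_mono (hu.integrable_abs.const_mul c) ((hd.const_mul _).sub hS) hle
  have h2 : |∫ x, radialBump x * symLap p u x| ≤ Kh * I := by
    rw [hI, ← integral_const_mul]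
    rw [← Real.norm_eq_abs]
    refine norm_integral_le_of_norm_le (hbi.const_mul Kh) (Eventually.of_forall fun x => ?_)
    rw [norm_mul, Real.norm_of_nonneg (radialBump_nonneg x), mul_comm]
    rcases lt_or_ge ‖x‖ 1 with h | h
    · exact mul_le_mul_of_nonneg_right (hKh x (mem_ball_zero_iff.2 h)) (radialBump_nonneg x)
    · simp [radialBump_eq_zero (show 1 / 8 ≤ ‖x‖ by linarith)]
  simp only [Pi.sub_apply] at h1
  rw [integral_const_mul, integral_sub (hd.const_mul _) hS, integral_const_mul,
    hu.integral_symLap_mul hn hp hp2 hb2 hasCompactSupport_radialBump] at h1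
  rw [mul_assoc, ← div_eq_inv_mul, le_div_iff₀ hc]
  have h3 := neg_abs_le (∫ x, radialBump x * symLap p u x)
  have h4 : 0 ≤ I * Ku := by positivity
  have h5 : 0 ≤ (c + C) * J * Kh := by positivity
  nlinarith

end TailBound

section InteriorEstimates

variable {n : ℕ} {p : ℝ} {u : Euc n → ℝ}

lemma Tame.local_formula (hn : 1 ≤ n) (hp : n < p) (hp2 : p < n + 2) (hu : Tame p u)
    {x : Euc n} (hx : x ∈ ball (0 : Euc n) (1 / 2)) :
    (∫ y : Euc n, avgKer p y) * u x = avgPart p u x +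
      scalePart (2 * n - 1 - p) profile ((ball (0 : Euc n) 1).indicator (symLap p u)) x := by
  rw [hu.representation hn hp hp2 x, avgPart, scalePart]
  congr 1
  refine setIntegral_congr_fun measurableSet_Ioi fun τ hτ => ?_
  have e := scaledInt_congr (Φ := (profile : Euc n → ℝ)) (h := symLap p u)
    (h' := (ball (0 : Euc n) 1).indicator (symLap p u)) (x := x) (le_of_lt hτ)
    (fun y hy => profile_eq_zero hy) fun z hz => ?_
  · simp only [e, smul_eq_mul]
  · rw [indicator_of_mem]
    rw [mem_ball_zero_iff] at hx ⊢
    rw [mem_ball, dist_eq_norm] at hz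
    linarith [norm_sub_norm_le z x]

lemma measurable_indicator_symLap (hu : Tame p u) :
    Measurable ((ball (0 : Euc n) 1).indicator (symLap p u)) :=
  (stronglyMeasurable_symLap hu.continuous).measurable.indicator measurableSet_ball

lemma abs_indicator_symLap_le {K : ℝ} (hK : ∀ x ∈ ball (0 : Euc n) 1, |symLap p u x| ≤ K)
    (z : Euc n) : |(ball (0 : Euc n) 1).indicator (symLap p u) z| ≤ K := by
  by_cases hz : z ∈ ball (0 : Euc n) 1
  · rw [indicator_of_mem hz]
    exact hK z hz
  · rw [indicator_of_notMem hz, abs_zero]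
    exact (abs_nonneg _).trans (hK 0 (mem_ball_self one_pos))

lemma integrable_indicator_symLap (hu : Tame p u) {K : ℝ}
    (hK : ∀ x ∈ ball (0 : Euc n) 1, |symLap p u x| ≤ K) :
    Integrable ((ball (0 : Euc n) 1).indicator (symLap p u)) := by
  rw [integrable_indicator_iff measurableSet_ball]
  exact Measure.integrableOn_of_bounded measure_ball_lt_top.ne
    (stronglyMeasurable_symLap hu.continuous).aestronglyMeasurable
    ((ae_restrict_iff' measurableSet_ball).2 (Eventually.of_forall hK))

lemma norm_sub_le_rpow {x x' : Euc n} (hx : x ∈ ball (0 : Euc n) (1 / 2))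
    (hx' : x' ∈ ball (0 : Euc n) (1 / 2)) {β : ℝ} (h1 : β ≤ 1) :
    ‖x - x'‖ ≤ 1 ∧ ‖x - x'‖ ≤ ‖x - x'‖ ^ β := by
  rw [mem_ball_zero_iff] at hx hx'
  have h : ‖x - x'‖ ≤ 1 := by linarith [norm_sub_le x x']
  refine ⟨h, ?_⟩
  rcases (norm_nonneg (x - x')).eq_or_lt with h' | h'
  · rw [← h']; positivity
  · simpa using Real.rpow_le_rpow_of_exponent_ge h' h h1

lemma fderiv_profile_eq_zero {x : Euc n} (hx : 1 / 4 ≤ ‖x‖) :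
    fderiv ℝ (profile : Euc n → ℝ) x = 0 := by
  refine IsLocalMin.fderiv_eq_zero (Eventually.of_forall fun y => ?_)
  rw [profile_eq_zero hx]
  exact profile_nonneg y

lemma ball_half_subset : ball (0 : Euc n) (1 / 2) ⊆ ball 0 1 := ball_subset_ball (by norm_num)

lemma exists_holder_bound (hn : 1 ≤ n) (hp : n < p) (hp2 : p < n + 2) {β : ℝ} (h0 : 0 ≤ β)
    (h1 : β ≤ 1) (hβ : n + β < p) :
    ∃ C, 0 ≤ C ∧ ∀ (u : Euc n → ℝ) (Kh Ku : ℝ), Tame p u → (∀ x, 0 ≤ u x) →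
      (∀ x ∈ ball (0 : Euc n) 1, |symLap p u x| ≤ Kh) → (∀ x ∈ ball (0 : Euc n) 1, u x ≤ Ku) →
      (∀ x ∈ ball (0 : Euc n) (1 / 2), |u x| ≤ C * (Kh + Ku)) ∧
      ∀ x ∈ ball (0 : Euc n) (1 / 2), ∀ x' ∈ ball (0 : Euc n) (1 / 2),
        |u x - u x'| ≤ C * (Kh + Ku) * ‖x - x'‖ ^ β := by
  obtain ⟨C₁, hC₁0, hC₁⟩ := exists_avgPart_bounds hn hp hp2
  obtain ⟨C₂, hC₂0, hC₂⟩ := exists_scalePart_bounds (n := n) (q := 2 * n - 1 - p)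
    (contDiff_profile.of_le (by norm_num)) (fun y hy => profile_eq_zero hy) h0 h1 (by linarith)
  obtain ⟨C₃, hC₃0, hC₃⟩ := exists_integral_decay_mul_le hn hp hp2
  have hκ := integral_avgKer_pos hn hp hp2
  set κ := ∫ y : Euc n, avgKer p y with hκdef
  refine ⟨κ⁻¹ * (C₁ * C₃ + C₂), by positivity, fun u Kh Ku hu hu0 hKh hKu => ?_⟩
  have hz : (0 : Euc n) ∈ ball (0 : Euc n) 1 := mem_ball_self one_pos
  have hKh0 : 0 ≤ Kh := (abs_nonneg _).trans (hKh 0 hz)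
  have hKu0 : 0 ≤ Ku := (hu0 0).trans (hKu 0 hz)
  obtain ⟨ha, -⟩ := hC₁ u hu
  obtain ⟨hb, hb'⟩ := hC₂ _ Kh (measurable_indicator_symLap hu) hKh0 (abs_indicator_symLap_le hKh)
  have hN := hC₃ u Kh Ku hu hu0 hKh hKu
  set N := ∫ z, decay p z * |u z| with hNdef
  have hN' : C₁ * N ≤ C₁ * C₃ * (Kh + Ku) := by
    rw [mul_assoc]; exact mul_le_mul_of_nonneg_left hN hC₁0
  have hK' : C₂ * Kh ≤ C₂ * (Kh + Ku) := mul_le_mul_of_nonneg_left (by linarith) hC₂0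
  refine ⟨fun x hx => ?_, fun x hx x' hx' => ?_⟩
  · have e := hu.local_formula hn hp hp2 hx
    rw [mul_assoc, ← div_eq_inv_mul, le_div_iff₀ hκ, ← abs_of_pos hκ, ← abs_mul, mul_comm, e]
    refine (abs_add_le _ _).trans ?_
    have h2 := (ha x (ball_half_subset hx)).2.1
    have h3 := hb x
    rw [Real.norm_eq_abs] at h3
    linarith
  · have e : (u x - u x') * κ = (avgPart p u x - avgPart p u x') +
        (scalePart (2 * n - 1 - p) profile ((ball (0 : Euc n) 1).indicator (symLap p u)) x -
        scalePart (2 * n - 1 - p) profile ((ball (0 : Euc n) 1).indicator (symLap p u)) x') := by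
      have := hu.local_formula hn hp hp2 hx
      have := hu.local_formula hn hp hp2 hx'
      linarith
    obtain ⟨-, hr⟩ := norm_sub_le_rpow hx hx' h1
    have hr0 : 0 ≤ ‖x - x'‖ ^ β := by positivity
    have h2 : ‖avgPart p u x - avgPart p u x'‖ ≤ C₁ * N * ‖x - x'‖ :=
      (convex_ball (0 : Euc n) 1).norm_image_sub_le_of_norm_hasFDerivWithin_le
        (fun y hy => (ha y hy).1.hasFDerivWithinAt) (fun y hy => (ha y hy).2.2)
        (ball_half_subset hx') (ball_half_subset hx)
    have h3 := hb' x x'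
    rw [mul_assoc, mul_assoc, ← div_eq_inv_mul, le_div_iff₀ hκ, ← abs_of_pos hκ, ← abs_mul, e]
    refine (abs_add_le _ _).trans ?_
    rw [← Real.norm_eq_abs, ← Real.norm_eq_abs]
    have h4 : C₁ * N * ‖x - x'‖ ≤ C₁ * C₃ * (Kh + Ku) * ‖x - x'‖ ^ β := by gcongr
    have h5 := mul_le_mul_of_nonneg_right hK' hr0
    linarith

lemma exists_gradient_holder_bound (hn : 1 ≤ n) (hp : n < p) (hp2 : p < n + 2) {β : ℝ}
    (h0 : 0 ≤ β) (h1 : β ≤ 1) (hβ : n + 1 + β < p) :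
    ∃ C, 0 ≤ C ∧ ∀ (u : Euc n → ℝ) (Kh Ku : ℝ), Tame p u → (∀ x, 0 ≤ u x) →
      (∀ x ∈ ball (0 : Euc n) 1, |symLap p u x| ≤ Kh) → (∀ x ∈ ball (0 : Euc n) 1, u x ≤ Ku) →
      (∀ x ∈ ball (0 : Euc n) (1 / 2), ‖fderiv ℝ u x‖ ≤ C * (Kh + Ku)) ∧
      ∀ x ∈ ball (0 : Euc n) (1 / 2), ∀ x' ∈ ball (0 : Euc n) (1 / 2),
        ‖fderiv ℝ u x - fderiv ℝ u x'‖ ≤ C * (Kh + Ku) * ‖x - x'‖ ^ β := by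
  obtain ⟨C₁, hC₁0, hC₁⟩ := exists_avgPart_bounds hn hp hp2
  obtain ⟨C₂, hC₂0, hC₂⟩ := exists_scalePart_bounds (n := n) (q := 2 * n - 1 - p + 1)
    (Φ := fderiv ℝ (profile : Euc n → ℝ)) (contDiff_fderiv_profile.of_le (by norm_num))
    (fun y hy => fderiv_profile_eq_zero hy) h0 h1 (by linarith)
  obtain ⟨C₃, hC₃0, hC₃⟩ := exists_integral_decay_mul_le hn hp hp2
  have hκ := integral_avgKer_pos hn hp hp2
  set κ := ∫ y : Euc n, avgKer p y with hκdef
  refine ⟨κ⁻¹ * (C₁ * C₃ + C₂), by positivity, fun u Kh Ku hu hu0 hKh hKu => ?_⟩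
  have hz : (0 : Euc n) ∈ ball (0 : Euc n) 1 := mem_ball_self one_pos
  have hKh0 : 0 ≤ Kh := (abs_nonneg _).trans (hKh 0 hz)
  have hKu0 : 0 ≤ Ku := (hu0 0).trans (hKu 0 hz)
  obtain ⟨ha, ha'⟩ := hC₁ u hu
  set h := (ball (0 : Euc n) 1).indicator (symLap p u) with hdef
  have hm : Measurable h := measurable_indicator_symLap hu
  have hh : ∀ z, |h z| ≤ Kh := abs_indicator_symLap_le hKh
  obtain ⟨hb, hb'⟩ := hC₂ h Kh hm hKh0 hh
  have hN := hC₃ u Kh Ku hu hu0 hKh hKu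
  set N := ∫ z, decay p z * |u z| with hNdef
  have hN' : C₁ * N ≤ C₁ * C₃ * (Kh + Ku) := by
    rw [mul_assoc]; exact mul_le_mul_of_nonneg_left hN hC₁0
  have hK' : C₂ * Kh ≤ C₂ * (Kh + Ku) := mul_le_mul_of_nonneg_left (by linarith) hC₂0
  have hf : ∀ x ∈ ball (0 : Euc n) (1 / 2), fderiv ℝ u x = κ⁻¹ • (davgPart p u x -
      scalePart (2 * n - 1 - p + 1) (fderiv ℝ profile) h x) := by
    intro x hx
    have d := ((ha x (ball_half_subset hx)).1.add (hasFDerivAt_scalePart hm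
      (integrable_indicator_symLap hu hKh) hh (q := 2 * n - 1 - p) (by linarith) x)).const_smul κ⁻¹
    rw [sub_eq_add_neg]
    refine (d.congr_of_eventuallyEq ?_).fderiv
    filter_upwards [isOpen_ball.mem_nhds hx] with y hy
    simp only [Pi.smul_apply, Pi.add_apply, smul_eq_mul]
    rw [← hu.local_formula hn hp hp2 hy, inv_mul_cancel_left₀ hκ.ne']
  have hκi : ‖κ⁻¹‖ = κ⁻¹ := Real.norm_of_nonneg (inv_pos.2 hκ).le
  refine ⟨fun x hx => ?_, fun x hx x' hx' => ?_⟩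
  · rw [hf x hx, norm_smul, hκi, mul_assoc]
    refine mul_le_mul_of_nonneg_left ((norm_sub_le _ _).trans ?_) (inv_pos.2 hκ).le
    have h2 := (ha x (ball_half_subset hx)).2.2
    have h3 := hb x
    linarith
  · obtain ⟨hle, hr⟩ := norm_sub_le_rpow hx hx' h1
    have hr0 : 0 ≤ ‖x - x'‖ ^ β := by positivity
    rw [hf x hx, hf x' hx', ← smul_sub, norm_smul, hκi, mul_assoc, mul_assoc,
      sub_sub_sub_comm]
    refine mul_le_mul_of_nonneg_left ((norm_sub_le _ _).trans ?_) (inv_pos.2 hκ).le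
    have h2 := ha' x (ball_half_subset hx) x' (ball_half_subset hx') hle
    have h3 := hb' x x'
    have h4 : C₁ * N * ‖x - x'‖ ≤ C₁ * C₃ * (Kh + Ku) * ‖x - x'‖ ^ β := by gcongr
    have h5 := mul_le_mul_of_nonneg_right hK' hr0
    linarith

end InteriorEstimates

section FinalReduction

variable {n : ℕ} {s : ℝ} {u : Euc n → ℝ}

lemma fracC_pos (hs0 : 0 < s) (hs1 : s < 1) : 0 < fracC n s := by
  have h1 : 0 < Real.Gamma ((n : ℝ) / 2 + s) := Real.Gamma_pos_of_pos (by positivity)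
  have h2 : 0 < Real.Gamma (1 - s) := Real.Gamma_pos_of_pos (by linarith)
  unfold fracC
  positivity

lemma C11LocOn.contDiff (hC : C11LocOn n u univ) : ContDiff ℝ 1 u := by
  refine contDiff_iff_contDiffAt.2 fun x => ?_
  obtain ⟨r, hr, -, hcd, -⟩ := hC x (mem_univ _)
  exact hcd.contDiffAt (ball_mem_nhds x hr)

lemma norm_iteratedFDeriv_zero_sub {F : Type*} [NormedAddCommGroup F] [NormedSpace ℝ F]
    (f : Euc n → F) (x y : Euc n) :
    ‖iteratedFDeriv ℝ 0 f x - iteratedFDeriv ℝ 0 f y‖ = ‖f x - f y‖ := by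
  rw [iteratedFDeriv_zero_eq_comp, Function.comp_apply, Function.comp_apply, ← map_sub,
    LinearIsometryEquiv.norm_map]

lemma norm_iteratedFDeriv_succ_sub (f : Euc n → ℝ) (k : ℕ) (x y : Euc n) :
    ‖iteratedFDeriv ℝ (k + 1) f x - iteratedFDeriv ℝ (k + 1) f y‖ =
      ‖iteratedFDeriv ℝ k (fderiv ℝ f) x - iteratedFDeriv ℝ k (fderiv ℝ f) y‖ := by
  rw [iteratedFDeriv_succ_eq_comp_right, iteratedFDeriv_succ_eq_comp_right, ← dist_eq_norm,
    ← dist_eq_norm]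
  exact LinearIsometryEquiv.dist_map _ _ _

lemma norm_iteratedFDeriv_one_sub (f : Euc n → ℝ) (x y : Euc n) :
    ‖iteratedFDeriv ℝ 1 f x - iteratedFDeriv ℝ 1 f y‖ = ‖fderiv ℝ f x - fderiv ℝ f y‖ :=
  (norm_iteratedFDeriv_succ_sub f 0 x y).trans (norm_iteratedFDeriv_zero_sub _ x y)

lemma HigherHolderBoundOn.mono {m : ℕ} {γ : ℝ} {K : Set (Euc n)} {A B : ℝ}
    (h : HigherHolderBoundOn n m γ u K A) (hAB : A ≤ B) : HigherHolderBoundOn n m γ u K B := by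
  refine ⟨h.1, fun k hk x hx => (h.2.1 k hk x hx).trans hAB, fun x hx y hy =>
    (h.2.2 x hx y hy).trans (mul_le_mul_of_nonneg_right hAB (by positivity))⟩

end FinalReduction

/-- interior Hölder regularity: if `u ∈ C^{1,1}_{loc}(ℝⁿ) ∩ L_{2s}` is a
nonnegative classical solution of `(-Δ)^s u = g` in `B₁(0)` with `g ∈ L^∞(B₁(0))`, then for
every `0 < ε < 2s`,
`‖u‖_{C^{[2s-ε],{2s-ε}}(B_{1/2})} ≤ C (‖g‖_{L^∞(B₁)} + ‖u‖_{L^∞(B₁)})`, `C = C(n,s,ε)`. -/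
theorem interior_holder_regularity
    (n : ℕ) (hn : 1 ≤ n) (s : ℝ) (hs0 : 0 < s) (hs1 : s < 1)
    (ε : ℝ) (hε0 : 0 < ε) (hε1 : ε < 2 * s) :
    ∃ C : ℝ, 0 < C ∧
      ∀ (u g : Euc n → ℝ) (Kg Ku : ℝ),
        (∀ x, 0 ≤ u x) → C11LocOn n u univ → MemL2s n s u →
        (∀ x ∈ ball (0 : Euc n) 1, HasFracLapAt n s u x (g x)) →
        (∀ x ∈ ball (0 : Euc n) 1, |g x| ≤ Kg) →
        (∀ x ∈ ball (0 : Euc n) 1, u x ≤ Ku) →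
        HigherHolderBoundOn n ⌊2 * s - ε⌋₊ (2 * s - ε - (⌊2 * s - ε⌋₊ : ℝ)) u
          (ball (0 : Euc n) (1/2)) (C * (Kg + Ku)) := by
  set p : ℝ := (n : ℝ) + 2 * s with hpdef
  have hp : n < p := by linarith
  have hp2 : p < n + 2 := by linarith
  have hc : 0 < fracC n s := fracC_pos hs0 hs1
  set c := fracC n s with hcdef
  have hγ0 : 0 ≤ 2 * s - ε := by linarith
  have main : ∃ C, 0 ≤ C ∧ ∀ (u : Euc n → ℝ) (Kh Ku : ℝ), Tame p u → C11LocOn n u univ →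
      (∀ x, 0 ≤ u x) → (∀ x ∈ ball (0 : Euc n) 1, |symLap p u x| ≤ Kh) →
      (∀ x ∈ ball (0 : Euc n) 1, u x ≤ Ku) →
      HigherHolderBoundOn n ⌊2 * s - ε⌋₊ (2 * s - ε - (⌊2 * s - ε⌋₊ : ℝ)) u
        (ball (0 : Euc n) (1 / 2)) (C * (Kh + Ku)) := by
    rcases lt_or_ge (2 * s - ε) 1 with h1 | h1
    · rw [Nat.floor_eq_zero.2 h1]
      obtain ⟨C, hC0, hC⟩ := exists_holder_bound hn hp hp2 hγ0 h1.le (by linarith)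
      refine ⟨C, hC0, fun u Kh Ku hu hC11 h0 hKh hKu => ?_⟩
      obtain ⟨hb, hb'⟩ := hC u Kh Ku hu h0 hKh hKu
      refine ⟨?_, fun k hk x hx => ?_, fun x hx y hy => ?_⟩
      · exact hC11.contDiff.contDiffOn.of_le (by norm_num)
      · rw [Nat.le_zero.1 hk, norm_iteratedFDeriv_zero]
        exact hb x hx
      · rw [norm_iteratedFDeriv_zero_sub, Nat.cast_zero, sub_zero, dist_eq_norm]
        exact hb' x hx y hy
    · have hfl : ⌊2 * s - ε⌋₊ = 1 := by
        rw [Nat.floor_eq_iff hγ0]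
        norm_num
        constructor <;> linarith
      rw [hfl]
      obtain ⟨C, hC0, hC⟩ := exists_holder_bound hn hp hp2 le_rfl zero_le_one (by linarith)
      obtain ⟨D, hD0, hD⟩ := exists_gradient_holder_bound hn hp hp2
        (β := 2 * s - ε - 1) (by linarith) (by linarith) (by linarith)
      refine ⟨C + D, by positivity, fun u Kh Ku hu hC11 h0 hKh hKu => ?_⟩
      have hz : (0 : Euc n) ∈ ball (0 : Euc n) 1 := mem_ball_self one_pos
      have hKh0 : 0 ≤ Kh := (abs_nonneg _).trans (hKh 0 hz)
      have hKu0 : 0 ≤ Ku := (h0 0).trans (hKu 0 hz)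
      have hK : 0 ≤ Kh + Ku := by positivity
      obtain ⟨hb, -⟩ := hC u Kh Ku hu h0 hKh hKu
      obtain ⟨hd, hd'⟩ := hD u Kh Ku hu h0 hKh hKu
      have hCle : C * (Kh + Ku) ≤ (C + D) * (Kh + Ku) := by gcongr; linarith
      have hDle : D * (Kh + Ku) ≤ (C + D) * (Kh + Ku) := by gcongr; linarith
      refine ⟨?_, fun k hk x hx => ?_, fun x hx y hy => ?_⟩
      · exact hC11.contDiff.contDiffOn.of_le (by norm_num)
      · interval_cases k
        · rw [norm_iteratedFDeriv_zero]
          exact (hb x hx).trans hCle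
        · rw [norm_iteratedFDeriv_one]
          exact (hd x hx).trans hDle
      · rw [norm_iteratedFDeriv_one_sub, Nat.cast_one, dist_eq_norm]
        exact (hd' x hx y hy).trans (mul_le_mul_of_nonneg_right hDle (by positivity))
  obtain ⟨C, hC0, hC⟩ := main
  refine ⟨C * (2 / c + 1) + 1, by positivity, fun u g Kg Ku h0 hC11 hL hg hKg hKu => ?_⟩
  have hu : Tame p u := tame_of_C11LocOn hC11 hC11.continuous
    (hL.integrable_decay_mul (by positivity) hC11.continuous)
  have hz : (0 : Euc n) ∈ ball (0 : Euc n) 1 := mem_ball_self one_pos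
  have hKg0 : 0 ≤ Kg := (abs_nonneg _).trans (hKg 0 hz)
  have hKu0 : 0 ≤ Ku := (h0 0).trans (hKu 0 hz)
  refine (hC u (2 / c * Kg) Ku hu hC11 h0 (fun x hx => ?_) hKu).mono ?_
  · have e := (hg x hx).eq_symLap hn hs0 hs1 hu
    have e' : symLap p u x = 2 / c * g x := by
      rw [e, ← hpdef, ← hcdef]
      field_simp
    rw [e', abs_mul, abs_of_pos (by positivity)]
    exact mul_le_mul_of_nonneg_left (hKg x hx) (by positivity)
  · have h2 : 0 ≤ C * Kg := by positivity
    have h3 : 0 ≤ 2 / c * (C * Ku) := by positivity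
    linarith
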